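/- arXiv:2404.04976 — 2 statements merged into one kernel-verified Lean document; each statement's English description precedes it below -/
import Mathlib

section
/- The L-theory RCF of real closed fields is model complete: whenever R₁ and R₂ are real closed fields such that R₁ is an L-substructure of R₂, then R₁ is an elementary L-substructure of R₂. -/
noncomputable section

open FirstOrder Language

/-- Real closed fields, axiomatized as in the paper: formally real, every odd degree
polynomial has a root, and every element is a square or the negative of a square. -/
class IsRealClosedField (R : Type*) [Field R] : Prop where
  formallyReal : ∀ (m : ℕ) (f : Fin m → R), ∑ i, f i ^ 2 ≠ -1
  oddDegreeRoot : ∀ p : Polynomial R, Odd p.natDegree → ∃ x : R, p.eval x = 0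
  sqOrNegSq : ∀ x : R, ∃ y : R, x = y ^ 2 ∨ x = -y ^ 2

attribute [local instance] FirstOrder.Ring.compatibleRingOfRing

namespace IsRealClosedField

open Polynomial

section Order

variable (R : Type*) [Field R] [IsRealClosedField R]

theorem sq_add_sq_ne_neg_one (a b : R) : a ^ 2 + b ^ 2 ≠ -1 := by
  simpa [Fin.sum_univ_two] using formallyReal 2 ![a, b]

theorem exists_sq_add_sq (a b : R) : ∃ c : R, a ^ 2 + b ^ 2 = c ^ 2 := by
  obtain ⟨c, hc | hc⟩ := sqOrNegSq (a ^ 2 + b ^ 2)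
  · exact ⟨c, hc⟩
  · by_cases h : c = 0
    · exact ⟨0, by simp [hc, h]⟩
    · refine absurd ?_ (sq_add_sq_ne_neg_one R (a / c) (b / c))
      field_simp
      exact hc

theorem eq_zero_of_sq_eq_neg_sq {a b : R} (h : a ^ 2 = -b ^ 2) : a = 0 := by
  by_cases hb : b = 0
  · simpa [hb] using h
  · refine absurd ?_ (sq_add_sq_ne_neg_one R (a / b) 0)
    field_simp
    simpa using h

/-- The order of a real closed field: the nonnegative elements are the squares. -/
abbrev linearOrder : LinearOrder R where
  le x y := ∃ z : R, y - x = z ^ 2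
  le_refl x := ⟨0, by simp⟩
  le_trans x y z := by
    rintro ⟨a, ha⟩ ⟨b, hb⟩
    obtain ⟨c, hc⟩ := exists_sq_add_sq R a b
    exact ⟨c, by rw [← hc, ← ha, ← hb]; ring⟩
  le_antisymm x y := by
    rintro ⟨a, ha⟩ ⟨b, hb⟩
    have : a = 0 := eq_zero_of_sq_eq_neg_sq R (b := b) (by rw [← ha, ← hb]; ring)
    rw [this] at ha
    linear_combination -ha
  le_total x y := by
    obtain ⟨z, hz | hz⟩ := sqOrNegSq (y - x)
    · exact Or.inl ⟨z, hz⟩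
    · exact Or.inr ⟨z, by linear_combination -hz⟩
  toDecidableLE := Classical.decRel _

theorem isStrictOrderedRing :
    letI := linearOrder R
    IsStrictOrderedRing R := by
  let := linearOrder R
  have : IsOrderedAddMonoid R :=
    { add_le_add_left := fun a b ⟨z, hz⟩ c => ⟨z, by rw [← hz]; ring⟩ }
  have : ZeroLEOneClass R := ⟨⟨1, by simp⟩⟩
  refine IsStrictOrderedRing.of_mul_pos fun a b ha hb => ?_
  obtain ⟨x, hx⟩ := ha.le
  obtain ⟨y, hy⟩ := hb.le
  refine lt_of_le_of_ne ⟨x * y, ?_⟩ (mul_ne_zero ha.ne' hb.ne').symm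
  rw [mul_pow, ← hx, ← hy]
  ring

end Order

section Galois

variable {R : Type*} [Field R] [IsRealClosedField R]

theorem finrank_eq_one_of_odd [CharZero R] {K : Type*} [Field K] [Algebra R K]
    [FiniteDimensional R K] (h : Odd (Module.finrank R K)) : Module.finrank R K = 1 := by
  obtain ⟨z, hz⟩ := Field.exists_primitive_element R K
  have hInt : IsIntegral R z := IsIntegral.of_finite R z
  have hdeg : (minpoly R z).natDegree = Module.finrank R K := by
    rw [← IntermediateField.adjoin.finrank hInt, hz, IntermediateField.finrank_top']
  obtain ⟨x, hx⟩ := oddDegreeRoot (minpoly R z) (hdeg ▸ h)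
  rw [← hdeg]
  exact natDegree_eq_of_degree_eq_some
    (degree_eq_one_of_irreducible_of_root (minpoly.irreducible hInt) hx)

theorem exists_finrank_eq_two_pow [CharZero R] (L : Type*) [Field L] [Algebra R L]
    [FiniteDimensional R L] [IsGalois R L] : ∃ k, Module.finrank R L = 2 ^ k := by
  have : Fact (Nat.Prime 2) := ⟨Nat.prime_two⟩
  let P : Sylow 2 Gal(L/R) := default
  obtain ⟨k, hk⟩ := P.isPGroup'.exists_card_eq
  have h1 : Module.finrank (IntermediateField.fixedField (P : Subgroup Gal(L/R))) L = 2 ^ k := by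
    rw [IntermediateField.finrank_fixedField_eq_card]
    exact hk
  have h2 := Module.finrank_mul_finrank R
    (IntermediateField.fixedField (P : Subgroup Gal(L/R))) L
  have h3 : (P : Subgroup Gal(L/R)).index
      = Module.finrank R (IntermediateField.fixedField (P : Subgroup Gal(L/R))) := by
    have h4 := (P : Subgroup Gal(L/R)).card_mul_index
    rw [IsGalois.card_aut_eq_finrank, ← h2, ← IntermediateField.finrank_fixedField_eq_card,
      mul_comm] at h4
    exact Nat.eq_of_mul_eq_mul_right Module.finrank_pos h4
  have h5 : Odd (Module.finrank R (IntermediateField.fixedField (P : Subgroup Gal(L/R)))) := by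
    rw [← h3, ← Nat.not_even_iff_odd, even_iff_two_dvd]
    exact P.not_dvd_index
  rw [finrank_eq_one_of_odd h5, one_mul] at h2
  exact ⟨k, h2 ▸ h1⟩

theorem finrank_ne_two_of_forall_isSquare {F E : Type*} [Field F] [Field E] [Algebra F E]
    [CharZero F] (hF : ∀ x : F, IsSquare x) : Module.finrank F E ≠ 2 := by
  intro h2
  have : FiniteDimensional F E := Module.finite_of_finrank_pos (by omega)
  obtain ⟨z, hz⟩ := Field.exists_primitive_element F E
  have hInt : IsIntegral F z := IsIntegral.of_finite F z
  have hdeg : (minpoly F z).natDegree = 2 := by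
    rw [← IntermediateField.adjoin.finrank hInt, hz, IntermediateField.finrank_top', h2]
  have hlc : (minpoly F z).coeff 2 ≠ 0 := by
    rw [← hdeg]
    exact leadingCoeff_ne_zero.2 (minpoly.ne_zero hInt)
  obtain ⟨s, hs⟩ := hF (discrim ((minpoly F z).coeff 2) ((minpoly F z).coeff 1)
    ((minpoly F z).coeff 0))
  obtain ⟨x, hx⟩ := exists_quadratic_eq_zero hlc ⟨s, hs⟩
  have hroot : (minpoly F z).IsRoot x := by
    rw [IsRoot, eval_eq_sum_range, hdeg]
    simp only [Finset.sum_range_succ, Finset.sum_range_zero]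
    linear_combination hx
  have h1 : (minpoly F z).natDegree = 1 := natDegree_eq_of_degree_eq_some
    (degree_eq_one_of_irreducible_of_root (minpoly.irreducible hInt) hroot)
  omega

variable [LinearOrder R] [IsStrictOrderedRing R]

theorem exists_sq_eq_of_nonneg {x : R} (hx : 0 ≤ x) : ∃ y : R, 0 ≤ y ∧ y ^ 2 = x := by
  obtain ⟨y, hy | hy⟩ := sqOrNegSq x
  · exact ⟨|y|, abs_nonneg y, by rw [sq_abs, hy]⟩
  · exact ⟨0, le_rfl, by nlinarith [sq_nonneg y]⟩

theorem exists_sq_sub_sq (a b : R) : ∃ u v : R, u ^ 2 - v ^ 2 = a ∧ 2 * u * v = b := by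
  obtain ⟨r, hr0, hr⟩ := exists_sq_eq_of_nonneg (add_nonneg (sq_nonneg a) (sq_nonneg b))
  have ha : |a| ≤ r := abs_le_of_sq_le_sq (by nlinarith [sq_nonneg b]) hr0
  obtain ⟨h1, h2⟩ := abs_le.1 ha
  obtain ⟨u, hu0, hu⟩ := exists_sq_eq_of_nonneg (show 0 ≤ (r + a) / 2 by linarith)
  obtain ⟨v, hv0, hv⟩ := exists_sq_eq_of_nonneg (show 0 ≤ (r - a) / 2 by linarith)
  have : (2 * u * v) ^ 2 = b ^ 2 := by
    rw [mul_pow, mul_pow, hu, hv]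
    linear_combination hr
  rcases sq_eq_sq_iff_eq_or_eq_neg.1 this with h | h
  · exact ⟨u, v, by rw [hu, hv]; ring, h⟩
  · exact ⟨u, -v, by rw [neg_sq, hu, hv]; ring, by linear_combination -h⟩

theorem isSquare_of_mem_adjoin {L : Type*} [Field L] [Algebra R L] {i : L} (hi : i ^ 2 = -1)
    (x : IntermediateField.adjoin R {i}) : IsSquare x := by
  have hInt : IsIntegral R i := ⟨X ^ 2 + 1, by monicity!, by simp [hi]⟩
  have hx : (x : L) ∈ (IntermediateField.adjoin R {i}).toSubalgebra := x.2
  rw [IntermediateField.adjoin_simple_toSubalgebra_of_isAlgebraic hInt.isAlgebraic,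
    Algebra.adjoin_singleton_eq_range_aeval] at hx
  obtain ⟨p, hp⟩ := hx
  have hmon : (X ^ 2 + 1 : R[X]).Monic := by monicity!
  have hdeg : (p %ₘ (X ^ 2 + 1)).natDegree ≤ 1 := by
    have := natDegree_modByMonic_lt p hmon (by
      intro h
      have := congrArg (eval 1) h
      norm_num at this
      )
    have h2 : (X ^ 2 + 1 : R[X]).natDegree = 2 := by compute_degree!
    omega
  obtain ⟨b, a, hab⟩ := exists_eq_X_add_C_of_natDegree_le_one hdeg
  obtain ⟨u, v, hu, hv⟩ := exists_sq_sub_sq a b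
  have hx' : (x : L) = algebraMap R L a + algebraMap R L b * i := by
    have h3 : aeval i (X ^ 2 + 1 : R[X]) = 0 := by simp [hi]
    have h4 := congrArg (aeval i) (modByMonic_add_div p (X ^ 2 + 1 : R[X]))
    rw [map_add, map_mul, h3, zero_mul, add_zero, hab] at h4
    simp only [map_add, map_mul, aeval_C, aeval_X] at h4
    rw [← hp]
    change _ = aeval i p at h4
    exact h4.symm.trans (add_comm _ _)
  have hiF : i ∈ IntermediateField.adjoin R {i} := IntermediateField.mem_adjoin_simple_self R i
  refine ⟨algebraMap R _ u + algebraMap R _ v * ⟨i, hiF⟩, ?_⟩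
  apply Subtype.ext
  change (x : L) = (algebraMap R L u + algebraMap R L v * i) *
    (algebraMap R L u + algebraMap R L v * i)
  rw [hx', ← hu, ← hv]
  simp only [map_sub, map_mul, map_pow, map_ofNat]
  linear_combination (-(algebraMap R L v) ^ 2) * hi

theorem finrank_le_two (L : Type*) [Field L] [Algebra R L] [FiniteDimensional R L]
    [IsGalois R L] {i : L} (hi : i ^ 2 = -1) : Module.finrank R L ≤ 2 := by
  have : CharZero R := inferInstance
  have : CharZero L := charZero_of_injective_algebraMap (algebraMap R L).injective
  let F := IntermediateField.adjoin R {i}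
  have : Fact (Nat.Prime 2) := ⟨Nat.prime_two⟩
  obtain ⟨k, hk⟩ := exists_finrank_eq_two_pow (R := R) L
  have hmul := Module.finrank_mul_finrank R F L
  obtain ⟨m, -, hm⟩ := (Nat.dvd_prime_pow Nat.prime_two).1
    (show Module.finrank F L ∣ 2 ^ k from ⟨Module.finrank R F, by rw [← hk, ← hmul, mul_comm]⟩)
  have hF2 : Module.finrank R F ≤ 2 := by
    have hInt : IsIntegral R i := IsIntegral.of_finite R i
    rw [IntermediateField.adjoin.finrank hInt]
    have h2 : (X ^ 2 + 1 : R[X]).natDegree = 2 := by compute_degree!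
    rw [← h2]
    exact natDegree_le_of_dvd (minpoly.dvd R i (by simp [hi]))
      (Monic.ne_zero (by monicity!))
  rcases m with _ | m
  · rw [hm] at hmul
    omega
  · exfalso
    have : IsGalois F L := IsGalois.tower_top_of_isGalois R F L
    have hcard : Nat.card Gal(L/F) = 2 ^ (m + 1) := by rw [IsGalois.card_aut_eq_finrank, hm]
    obtain ⟨H, hH⟩ := Sylow.exists_subgroup_card_pow_prime (G := Gal(L/F)) 2 (n := m)
      (by rw [hcard]; exact pow_dvd_pow 2 (Nat.le_succ m))
    have h1 : Module.finrank (IntermediateField.fixedField H) L = 2 ^ m := by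
      rw [IntermediateField.finrank_fixedField_eq_card, hH]
    have h2 := Module.finrank_mul_finrank F (IntermediateField.fixedField H) L
    rw [h1, hm, pow_succ, mul_comm] at h2
    exact finrank_ne_two_of_forall_isSquare (F := F) (isSquare_of_mem_adjoin hi)
      (Nat.eq_of_mul_eq_mul_left (by positivity) h2)

theorem natDegree_le_two_of_irreducible {p : R[X]} (hp : Irreducible p) : p.natDegree ≤ 2 := by
  have hq0 : (X ^ 2 + 1 : R[X]) ≠ 0 := Monic.ne_zero (by monicity!)
  let q : R[X] := p * (X ^ 2 + 1)
  let L := q.SplittingField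
  have hs : (q.map (algebraMap R L)).Splits := SplittingField.splits q
  have hsp : (p.map (algebraMap R L)).Splits ∧
      ((X ^ 2 + 1 : R[X]).map (algebraMap R L)).Splits := by
    rw [Polynomial.map_mul] at hs
    exact (splits_mul (map_ne_zero hp.ne_zero) (map_ne_zero hq0)).1 hs
  obtain ⟨i, hi⟩ := hsp.2.exists_eval_eq_zero (by
    rw [degree_map]
    have : (X ^ 2 + 1 : R[X]).degree = 2 := by compute_degree!
    simp [this])
  obtain ⟨z, hz⟩ := hsp.1.exists_eval_eq_zero (by
    rw [degree_map]
    exact hp.degree_pos.ne')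
  have : IsGalois R L := { }
  have h2 := finrank_le_two (R := R) L (i := i) (by
    simp at hi
    linear_combination hi)
  have hInt : IsIntegral R z := IsIntegral.of_finite R z
  have hdvd : minpoly R z ∣ p := minpoly.dvd R z (by rwa [eval_map_algebraMap] at hz)
  have hassoc := (minpoly.irreducible hInt).associated_of_dvd hp hdvd
  rw [← natDegree_eq_of_degree_eq (degree_eq_degree_of_associated hassoc)]
  exact (minpoly.natDegree_le z).trans h2

end Galois

end IsRealClosedField

namespace IsRealClosedField

open Polynomial

variable {R : Type*} [Field R] [IsRealClosedField R] [LinearOrder R] [IsStrictOrderedRing R]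

theorem eval_mul_eval_pos_of_irreducible {p : R[X]} (hp : Irreducible p) {a b : R}
    (h : ∀ x ∈ Set.Icc a b, p.eval x ≠ 0) (hab : a ≤ b) : 0 < p.eval a * p.eval b := by
  have h0 : 0 < p.natDegree := hp.natDegree_pos
  have h2 := natDegree_le_two_of_irreducible hp
  obtain h1 | h2 : p.natDegree = 1 ∨ p.natDegree = 2 := by omega
  · obtain ⟨c, d, hcd⟩ := exists_eq_X_add_C_of_natDegree_le_one h1.le
    have hev : ∀ x, p.eval x = c * x + d := fun x => by rw [hcd]; simp
    have hc : c ≠ 0 := by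
      rintro rfl
      rw [hcd] at h1
      simp at h1
    have hr : ¬ (a ≤ -d / c ∧ -d / c ≤ b) := fun hr => h _ hr (by rw [hev]; field_simp; ring)
    have hx : ∀ x, p.eval x = c * (x - -d / c) := fun x => by rw [hev]; field_simp; ring
    rw [hx, hx, show c * (a - -d / c) * (c * (b - -d / c))
      = c ^ 2 * ((a - -d / c) * (b - -d / c)) by ring]
    refine mul_pos (by positivity) ?_
    rcases not_and_or.1 hr with hr | hr
    · exact mul_pos (by linarith) (by linarith)
    · exact mul_pos_of_neg_of_neg (by linarith) (by linarith)
  · have hev : ∀ x, p.eval x = p.coeff 2 * (x * x) + p.coeff 1 * x + p.coeff 0 := fun x => by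
      rw [eval_eq_sum_range, h2]
      simp only [Finset.sum_range_succ, Finset.sum_range_zero]
      ring
    have hlc : p.coeff 2 ≠ 0 := by
      rw [← h2]
      exact leadingCoeff_ne_zero.2 hp.ne_zero
    have hneg : discrim (p.coeff 2) (p.coeff 1) (p.coeff 0) < 0 := by
      by_contra! hd
      obtain ⟨s, -, hs⟩ := exists_sq_eq_of_nonneg hd
      obtain ⟨x, hx⟩ := exists_quadratic_eq_zero hlc ⟨s, by rw [← hs, sq]⟩
      have h1 : p.natDegree = 1 := natDegree_eq_of_degree_eq_some
        (degree_eq_one_of_irreducible_of_root hp ((hev x).trans hx))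
      omega
    have hpos : ∀ x, 0 < p.coeff 2 * p.eval x := fun x => by
      rw [hev]
      rw [discrim] at hneg
      nlinarith [sq_nonneg (2 * p.coeff 2 * x + p.coeff 1)]
    have := mul_pos (hpos a) (hpos b)
    rw [show p.coeff 2 * p.eval a * (p.coeff 2 * p.eval b)
      = p.coeff 2 ^ 2 * (p.eval a * p.eval b) by ring] at this
    exact pos_of_mul_pos_right this (sq_nonneg _)

theorem eval_mul_eval_pos {p : R[X]} {a b : R} (h : ∀ x ∈ Set.Icc a b, p.eval x ≠ 0)
    (hab : a ≤ b) : 0 < p.eval a * p.eval b := by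
  induction p using WfDvdMonoid.induction_on_irreducible with
  | zero => exact absurd eval_zero (h a ⟨le_rfl, hab⟩)
  | unit u hu =>
    obtain ⟨c, -, rfl⟩ := isUnit_iff.1 hu
    have hc := h a ⟨le_rfl, hab⟩
    rw [eval_C] at hc
    simpa using mul_self_pos.2 hc
  | mul q i hq hi ih =>
    simp only [eval_mul] at h ⊢
    have h1 := eval_mul_eval_pos_of_irreducible hi
      (fun x hx => left_ne_zero_of_mul (h x hx)) hab
    have h2 := ih (fun x hx => right_ne_zero_of_mul (h x hx))
    rw [mul_mul_mul_comm]
    exact mul_pos h1 h2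

/-- The intermediate value theorem for polynomials over a real closed field. -/
theorem exists_eval_eq_zero_of_mul_neg {p : R[X]} {a b : R} (hab : a ≤ b)
    (h : p.eval a * p.eval b < 0) : ∃ c ∈ Set.Ioo a b, p.eval c = 0 := by
  by_contra! hc
  refine (eval_mul_eval_pos (p := p) (fun x hx hx0 => ?_) hab).not_gt h
  rcases hx.1.eq_or_lt with rfl | h1
  · simp [hx0] at h
  rcases hx.2.eq_or_lt with rfl | h2
  · simp [hx0] at h
  exact hc x ⟨h1, h2⟩ hx0

theorem exists_derivative_eq_zero_of_consecutive {p : R[X]} {a b : R} (hab : a < b)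
    (ha : p.eval a = 0) (hb : p.eval b = 0) (h : ∀ x ∈ Set.Ioo a b, p.eval x ≠ 0) :
    ∃ c ∈ Set.Ioo a b, p.derivative.eval c = 0 := by
  have hp : p ≠ 0 := by
    rintro rfl
    obtain ⟨c, hc⟩ := exists_between hab
    exact h c hc eval_zero
  obtain ⟨q, hq, hqa⟩ := exists_eq_pow_rootMultiplicity_mul_and_not_dvd p hp a
  have hq0 : q ≠ 0 := by
    rintro rfl
    exact hqa (dvd_zero _)
  obtain ⟨g, hg, hgb⟩ := exists_eq_pow_rootMultiplicity_mul_and_not_dvd q hq0 b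
  obtain ⟨m, hm⟩ : ∃ m, p.rootMultiplicity a = m + 1 :=
    Nat.exists_eq_succ_of_ne_zero ((rootMultiplicity_pos hp).2 ha).ne'
  have hqb : q.eval b = 0 := by
    rw [hq, eval_mul, eval_pow] at hb
    simpa [sub_ne_zero.2 hab.ne'] using hb
  obtain ⟨n, hn⟩ : ∃ n, q.rootMultiplicity b = n + 1 :=
    Nat.exists_eq_succ_of_ne_zero ((rootMultiplicity_pos hq0).2 hqb).ne'
  rw [hm] at hq
  rw [hn] at hg
  rw [dvd_iff_isRoot, IsRoot] at hqa hgb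
  have hga : g.eval a ≠ 0 := fun h0 => hqa (by rw [hg, eval_mul, h0, mul_zero])
  have hpos : 0 < g.eval a * g.eval b := by
    refine eval_mul_eval_pos (fun x hx hx0 => ?_) hab.le
    rcases hx.1.eq_or_lt with rfl | h1
    · exact hga hx0
    rcases hx.2.eq_or_lt with rfl | h2
    · exact hgb hx0
    exact h x ⟨h1, h2⟩ (by rw [hq, hg, eval_mul, eval_mul, hx0, mul_zero, mul_zero])
  let r : R[X] := (m + 1 : R[X]) * (X - C b) * g + (n + 1 : R[X]) * (X - C a) * g
    + (X - C a) * (X - C b) * derivative g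
  have hr : derivative p = (X - C a) ^ m * (X - C b) ^ n * r := by
    rw [hq, hg]
    simp only [derivative_mul, derivative_pow, derivative_sub, derivative_X, derivative_C, r]
    push_cast
    simp only [map_add, map_natCast, map_one]
    ring
  obtain ⟨c, hc, hrc⟩ := exists_eval_eq_zero_of_mul_neg (p := r) hab.le (by
    have e1 : r.eval a = (m + 1) * (a - b) * g.eval a := by simp [r]
    have e2 : r.eval b = (n + 1) * (b - a) * g.eval b := by simp [r]
    rw [e1, e2, show (m + 1) * (a - b) * g.eval a * ((n + 1) * (b - a) * g.eval b)
      = -((m + 1) * (n + 1) * (b - a) ^ 2 * (g.eval a * g.eval b)) by ring]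
    have : 0 < b - a := sub_pos.2 hab
    exact neg_neg_of_pos (by positivity))
  exact ⟨c, hc, by rw [hr, eval_mul, hrc, mul_zero]⟩

/-- Rolle's theorem for polynomials over a real closed field. -/
theorem exists_derivative_eq_zero {p : R[X]} {a b : R} (hab : a < b)
    (ha : p.eval a = 0) (hb : p.eval b = 0) : ∃ c ∈ Set.Ioo a b, p.derivative.eval c = 0 := by
  rcases eq_or_ne p 0 with rfl | hp
  · obtain ⟨c, hc⟩ := exists_between hab
    exact ⟨c, hc, by simp⟩
  have hne : {x ∈ p.roots.toFinset | a < x}.Nonempty := ⟨b, by simp [hp, hb, hab]⟩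
  obtain ⟨d, hd, hmin⟩ := Finset.exists_minimal hne
  simp only [Finset.mem_filter, Multiset.mem_toFinset, mem_roots hp, IsRoot] at hd hmin
  have hdb : d ≤ b := by
    rcases le_total d b with h | h
    · exact h
    · exact hmin ⟨hb, hab⟩ h
  obtain ⟨c, hc, h0⟩ := exists_derivative_eq_zero_of_consecutive hd.2 ha hd.1
    (fun x hx h0 => (hmin ⟨h0, hx.1⟩ hx.2.le).not_gt hx.2)
  exact ⟨c, ⟨hc.1, hc.2.trans_le hdb⟩, h0⟩

/-- The mean value theorem for polynomials over a real closed field. -/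
theorem exists_eval_sub_eq {p : R[X]} {a b : R} (hab : a < b) :
    ∃ c ∈ Set.Ioo a b, p.eval b - p.eval a = p.derivative.eval c * (b - a) := by
  have h0 : b - a ≠ 0 := (sub_pos.2 hab).ne'
  obtain ⟨c, hc, h⟩ := exists_derivative_eq_zero
    (p := p - C ((p.eval b - p.eval a) / (b - a)) * (X - C a) - C (p.eval a)) hab
    (by simp) (by simp [h0])
  refine ⟨c, hc, ?_⟩
  simp only [derivative_sub, derivative_mul, derivative_C, derivative_X, eval_sub, eval_mul,
    eval_C, eval_add, eval_zero, eval_one] at h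
  field_simp at h
  linear_combination -h

end IsRealClosedField

section SignAtInfinity

open Polynomial

variable {R : Type*} [Field R] [LinearOrder R] [IsStrictOrderedRing R]

theorem Polynomial.exists_forall_le_eval_of_leadingCoeff_pos {p : R[X]}
    (h : 0 < p.leadingCoeff) : ∃ ε > 0, ∃ M, ∀ x ≥ M, ε ≤ p.eval x := by
  induction hn : p.natDegree generalizing p with
  | zero =>
    rw [eq_C_of_natDegree_eq_zero hn] at h ⊢
    rw [leadingCoeff_C] at h
    exact ⟨_, h, 0, fun x _ => by rw [eval_C]⟩
  | succ n ih =>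
    have hd : p.divX.natDegree = n := by rw [natDegree_divX_eq_natDegree_tsub_one, hn]; rfl
    obtain ⟨ε, hε, M, hM⟩ := ih (p := p.divX) (by
      rw [leadingCoeff, hd, coeff_divX, ← hn]
      exact h) hd
    refine ⟨ε, hε, max M (max 0 ((ε - p.coeff 0) / ε)), fun x hx => ?_⟩
    simp only [ge_iff_le, max_le_iff] at hx
    have h1 := hM x hx.1
    have h2 := (div_le_iff₀ hε).1 hx.2.2
    have h3 : p.eval x = p.divX.eval x * x + p.coeff 0 := by
      conv_lhs => rw [← divX_mul_X_add p]
      simp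
    rw [h3]
    nlinarith [mul_le_mul_of_nonneg_right h1 hx.2.1]

theorem Polynomial.exists_forall_ge_sign_eval (p : R[X]) :
    ∃ M, ∀ x ≥ M, SignType.sign (p.eval x) = SignType.sign p.leadingCoeff := by
  rcases lt_trichotomy p.leadingCoeff 0 with h | h | h
  · obtain ⟨ε, hε, M, hM⟩ := exists_forall_le_eval_of_leadingCoeff_pos (p := -p) (by simpa)
    refine ⟨M, fun x hx => ?_⟩
    have := hM x hx
    rw [eval_neg] at this
    rw [sign_neg h, sign_neg (by linarith)]
  · exact ⟨0, fun x _ => by simp [leadingCoeff_eq_zero.1 h]⟩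
  · obtain ⟨ε, hε, M, hM⟩ := exists_forall_le_eval_of_leadingCoeff_pos h
    exact ⟨M, fun x hx => by rw [sign_pos h, sign_pos (hε.trans_le (hM x hx))]⟩

theorem Polynomial.exists_forall_le_sign_eval (p : R[X]) :
    ∃ M, ∀ x ≤ M, SignType.sign (p.eval x)
      = (-1) ^ p.natDegree * SignType.sign p.leadingCoeff := by
  obtain ⟨M, hM⟩ := (p.comp (-X)).exists_forall_ge_sign_eval
  refine ⟨-M, fun x hx => ?_⟩
  have := hM (-x) (by linarith)
  rw [leadingCoeff_comp (by simp), leadingCoeff_neg, leadingCoeff_X, sign_mul, sign_pow,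
    sign_neg (show (-1 : R) < 0 by simp), mul_comm] at this
  simpa using this

end SignAtInfinity

section Matching

open Polynomial SignType

/-- `x` and `y` occupy the same position relative to the pairs in `F`. -/
def SameCell {α β : Type*} [LT α] [LT β] (F : Set (α × β)) (x : α) (y : β) : Prop :=
  ∀ a b, (a, b) ∈ F → (a < x ↔ b < y) ∧ (x < a ↔ y < b)

namespace SameCell

variable {α β : Type*} [LinearOrder α] [LinearOrder β] {F : Set (α × β)}

theorem swap {x : α} {y : β} (h : SameCell F x y) : SameCell (Prod.swap ⁻¹' F) y x :=
  fun b a hab => ⟨(h a b hab).1.symm, (h a b hab).2.symm⟩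

theorem anti {G : Set (α × β)} {x : α} {y : β} (h : SameCell F x y) (hG : G ⊆ F) :
    SameCell G x y :=
  fun a b hab => h a b (hG hab)

theorem right_eq {x : α} {y b : β} (h : SameCell F x y) (hb : (x, b) ∈ F) : b = y := by
  have := h x b hb
  simp only [lt_self_iff_false, false_iff, not_lt] at this
  exact le_antisymm this.2 this.1

theorem of_mem_Icc_right {x : α} {y₀ z y₁ : β} (h₀ : SameCell F x y₀) (h₁ : SameCell F x y₁)
    (hz₀ : y₀ ≤ z) (hz₁ : z ≤ y₁) : SameCell F x z := fun a b hab =>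
  ⟨⟨fun h => ((h₀ a b hab).1.1 h).trans_le hz₀, fun h => (h₁ a b hab).1.2 (h.trans_le hz₁)⟩,
    ⟨fun h => hz₁.trans_lt ((h₁ a b hab).2.1 h), fun h => (h₀ a b hab).2.2 (hz₀.trans_lt h)⟩⟩

theorem of_mem_Icc_left {x₀ z x₁ : α} {y : β} (h₀ : SameCell F x₀ y) (h₁ : SameCell F x₁ y)
    (hz₀ : x₀ ≤ z) (hz₁ : z ≤ x₁) : SameCell F z y :=
  (h₀.swap.of_mem_Icc_right h₁.swap hz₀ hz₁).swap

theorem exists_right [DenselyOrdered β] [NoMinOrder β] [NoMaxOrder β] [Nonempty β]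
    (hF : F.Finite) (iso : ∀ a b, (a, b) ∈ F → SameCell F a b) (x : α) :
    ∃ y, SameCell F x y := by
  have key : ∀ (a x : α) (b y : β),
      cmp a x = cmp b y ↔ (a < x ↔ b < y) ∧ (x < a ↔ y < b) := fun a x b y => by
    rcases lt_trichotomy a x with h | h | h <;> rcases lt_trichotomy b y with h' | h' | h' <;>
      simp [cmp, cmpUsing, h, h', h.not_gt, h'.not_gt]
  obtain ⟨y, hy⟩ := Order.PartialIso.exists_across (β := β)
    ⟨hF.toFinset, fun p hp q hq => by
      rw [Set.Finite.mem_toFinset] at hp hq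
      exact (key _ _ _ _).2 (iso _ _ hq _ _ hp)⟩ x
  exact ⟨y, fun a b hab => (key _ _ _ _).1 (hy (a, b) (by simpa using hab))⟩

end SameCell

set_option linter.unusedSectionVars false

variable {R₁ R₂ : Type*} [Field R₁] [IsRealClosedField R₁] [LinearOrder R₁]
  [IsStrictOrderedRing R₁] [Field R₂] [IsRealClosedField R₂] [LinearOrder R₂]
  [IsStrictOrderedRing R₂]

/-- The finite partial isomorphism `F` separates the roots of the derivatives of `p` and `q`, and
knows the signs of `p`, `q` at its points and at infinity, and of the derivatives everywhere. -/
structure SeparatesDerivativeRoots (F : Set (R₁ × R₂)) (p : R₁[X]) (q : R₂[X]) : Prop where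
  finite : F.Finite
  iso : ∀ a b, (a, b) ∈ F → SameCell F a b
  sign_derivative : ∀ x y, SameCell F x y →
    sign (p.derivative.eval x) = sign (q.derivative.eval y)
  left_mem : ∀ x, p.derivative.eval x = 0 → ∃ y, (x, y) ∈ F
  right_mem : ∀ y, q.derivative.eval y = 0 → ∃ x, (x, y) ∈ F
  sign_eval : ∀ x y, (x, y) ∈ F → sign (p.eval x) = sign (q.eval y)
  sign_atTop : ∃ s M N, (∀ x ≥ M, sign (p.eval x) = s) ∧ ∀ y ≥ N, sign (q.eval y) = s
  sign_atBot : ∃ s M N, (∀ x ≤ M, sign (p.eval x) = s) ∧ ∀ y ≤ N, sign (q.eval y) = s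

namespace SeparatesDerivativeRoots

variable {F : Set (R₁ × R₂)} {p : R₁[X]} {q : R₂[X]}

theorem swap (h : SeparatesDerivativeRoots F p q) :
    SeparatesDerivativeRoots (Prod.swap ⁻¹' F) q p where
  finite := h.finite.preimage Prod.swap_injective.injOn
  iso a b hab := (h.iso b a hab).swap
  sign_derivative x y hxy := (h.sign_derivative y x hxy.swap).symm
  left_mem := h.right_mem
  right_mem := h.left_mem
  sign_eval x y hxy := (h.sign_eval y x hxy).symm
  sign_atTop := let ⟨s, M, N, h₁, h₂⟩ := h.sign_atTop; ⟨s, N, M, h₂, h₁⟩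
  sign_atBot := let ⟨s, M, N, h₁, h₂⟩ := h.sign_atBot; ⟨s, N, M, h₂, h₁⟩

theorem neg (h : SeparatesDerivativeRoots F p q) : SeparatesDerivativeRoots F (-p) (-q) where
  finite := h.finite
  iso := h.iso
  sign_derivative x y hxy := by simp [Left.sign_neg, h.sign_derivative x y hxy]
  left_mem x hx := h.left_mem x (by simpa using hx)
  right_mem y hy := h.right_mem y (by simpa using hy)
  sign_eval x y hxy := by simp [Left.sign_neg, h.sign_eval x y hxy]
  sign_atTop := let ⟨s, M, N, h₁, h₂⟩ := h.sign_atTop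
    ⟨-s, M, N, fun x hx => by simp [Left.sign_neg, h₁ x hx],
      fun x hx => by simp [Left.sign_neg, h₂ x hx]⟩
  sign_atBot := let ⟨s, M, N, h₁, h₂⟩ := h.sign_atBot
    ⟨-s, M, N, fun x hx => by simp [Left.sign_neg, h₁ x hx],
      fun x hx => by simp [Left.sign_neg, h₂ x hx]⟩

theorem derivative_pos (h : SeparatesDerivativeRoots F p q) {x c : R₁} {y : R₂}
    (hx : SameCell F x y) (hc : SameCell F c y) (hpos : 0 < p.derivative.eval x) :
    0 < p.derivative.eval c := by
  rwa [← sign_eq_one_iff, h.sign_derivative c y hc, ← h.sign_derivative x y hx, sign_eq_one_iff]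

theorem eval_lt_eval (h : SeparatesDerivativeRoots F p q) {x a b : R₁} {y : R₂}
    (hx : SameCell F x y) (hpos : 0 < p.derivative.eval x) (hab : a < b)
    (hc : ∀ c ∈ Set.Ioo a b, SameCell F c y) : p.eval a < p.eval b := by
  obtain ⟨c, hcab, hc'⟩ := IsRealClosedField.exists_eval_sub_eq (p := p) hab
  have := mul_pos (h.derivative_pos hx (hc c hcab) hpos) (sub_pos.2 hab)
  linarith

theorem exists_ge_eval_pos (h : SeparatesDerivativeRoots F p q) {x : R₁} {y : R₂}
    (hx : SameCell F x y) (hxF : ∀ b, (x, b) ∉ F) (hpos : 0 < p.derivative.eval x)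
    (hp : 0 ≤ p.eval x) : ∃ y₁ ≥ y, SameCell F x y₁ ∧ 0 < q.eval y₁ := by
  have hne : ∀ a b, (a, b) ∈ F → a ≠ x := by
    rintro a b hab rfl
    exact hxF b hab
  rcases {z ∈ F | x < z.1}.eq_empty_or_nonempty with hS | hS
  · have hlt : ∀ a b, (a, b) ∈ F → a < x := fun a b hab =>
      lt_of_le_of_ne (not_lt.1 fun hxa => hS.subset ⟨hab, hxa⟩) (hne a b hab)
    obtain ⟨s, M, N, hM, hN⟩ := h.sign_atTop
    have hgt : p.eval x < p.eval (max M (x + 1)) := by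
      refine h.eval_lt_eval hx hpos (lt_max_of_lt_right (lt_add_one x)) fun c hc a b hab => ?_
      have h1 := hlt a b hab
      have h2 := (hx a b hab).1.1 h1
      exact ⟨iff_of_true (h1.trans hc.1) h2, iff_of_false (h1.trans hc.1).not_gt h2.not_gt⟩
    have hs : s = 1 := by
      rw [← hM _ (le_max_left M (x + 1)), sign_eq_one_iff]
      exact hp.trans_lt hgt
    refine ⟨max N y, le_max_right _ _, fun a b hab => ?_, ?_⟩
    · have h1 := hlt a b hab
      have h2 := ((hx a b hab).1.1 h1).trans_le (le_max_right N y)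
      exact ⟨iff_of_true h1 h2, iff_of_false h1.not_gt h2.not_gt⟩
    · rw [← sign_eq_one_iff, hN _ (le_max_left _ _), hs]
  · obtain ⟨⟨a, b⟩, ⟨hab, hxa⟩, hmin⟩ := Set.exists_min_image {z ∈ F | x < z.1} Prod.fst
      (h.finite.subset (Set.sep_subset _ _)) hS
    simp only [Set.mem_ofPred_eq, and_imp, Prod.forall] at hmin hxa
    have hyb := (hx a b hab).2.1 hxa
    have hgt : p.eval x < p.eval a := by
      refine h.eval_lt_eval hx hpos hxa fun c hc a' b' hab' => ?_
      rcases (hne a' b' hab').lt_or_gt with h1 | h1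
      · have h2 := (hx a' b' hab').1.1 h1
        exact ⟨iff_of_true (h1.trans hc.1) h2, iff_of_false (h1.trans hc.1).not_gt h2.not_gt⟩
      · have h2 := (hx a' b' hab').2.1 h1
        have h3 := hc.2.trans_le (hmin a' b' hab' h1)
        exact ⟨iff_of_false h3.not_gt h2.not_gt, iff_of_true h3 h2⟩
    have hqb : 0 < q.eval b := by
      rw [← sign_eq_one_iff, ← h.sign_eval a b hab, sign_eq_one_iff]
      exact hp.trans_lt hgt
    have hcell : ∀ y₁, y ≤ y₁ → y₁ < b → SameCell F x y₁ := fun y₁ h₁ h₂ a' b' hab' => by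
      rcases (hne a' b' hab').lt_or_gt with h1 | h1
      · have h3 := ((hx a' b' hab').1.1 h1).trans_le h₁
        exact ⟨iff_of_true h1 h3, iff_of_false h1.not_gt h3.not_gt⟩
      · have h3 : b ≤ b' := not_lt.1 fun hb =>
          (hmin a' b' hab' h1).not_gt (((h.iso a b hab) a' b' hab').1.2 hb)
        have h4 := h₂.trans_le h3
        exact ⟨iff_of_false h1.not_gt h4.not_gt, iff_of_true h1 h4⟩
    rcases lt_or_ge 0 (q.eval y) with hy | hy
    · exact ⟨y, le_rfl, hx, hy⟩
    · obtain ⟨c, hc, hc0⟩ := IsRealClosedField.exists_eval_eq_zero_of_mul_neg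
        (p := q - C (q.eval b / 2)) hyb.le (by
          simp only [eval_sub, eval_C]
          exact mul_neg_of_neg_of_pos (by linarith) (by linarith))
      refine ⟨c, hc.1.le, hcell c hc.1.le hc.2, ?_⟩
      simp only [eval_sub, eval_C] at hc0
      linarith

theorem exists_le_eval_neg (h : SeparatesDerivativeRoots F p q) {x : R₁} {y : R₂}
    (hx : SameCell F x y) (hxF : ∀ b, (x, b) ∉ F) (hpos : 0 < p.derivative.eval x)
    (hp : p.eval x ≤ 0) : ∃ y₀ ≤ y, SameCell F x y₀ ∧ q.eval y₀ < 0 := by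
  have hne : ∀ a b, (a, b) ∈ F → a ≠ x := by
    rintro a b hab rfl
    exact hxF b hab
  rcases {z ∈ F | z.1 < x}.eq_empty_or_nonempty with hS | hS
  · have hlt : ∀ a b, (a, b) ∈ F → x < a := fun a b hab =>
      lt_of_le_of_ne (not_lt.1 fun hxa => hS.subset ⟨hab, hxa⟩) (hne a b hab).symm
    obtain ⟨s, M, N, hM, hN⟩ := h.sign_atBot
    have hgt : p.eval (min M (x - 1)) < p.eval x := by
      refine h.eval_lt_eval hx hpos (min_lt_of_right_lt (sub_one_lt x)) fun c hc a b hab => ?_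
      have h1 := hlt a b hab
      have h2 := (hx a b hab).2.1 h1
      exact ⟨iff_of_false (hc.2.trans h1).not_gt h2.not_gt, iff_of_true (hc.2.trans h1) h2⟩
    have hs : s = -1 := by
      rw [← hM _ (min_le_left M (x - 1)), sign_eq_neg_one_iff]
      exact hgt.trans_le hp
    refine ⟨min N y, min_le_right _ _, fun a b hab => ?_, ?_⟩
    · have h1 := hlt a b hab
      have h2 := (min_le_right N y).trans_lt ((hx a b hab).2.1 h1)
      exact ⟨iff_of_false h1.not_gt h2.not_gt, iff_of_true h1 h2⟩
    · rw [← sign_eq_neg_one_iff, hN _ (min_le_left _ _), hs]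
  · obtain ⟨⟨a, b⟩, ⟨hab, hxa⟩, hmax⟩ := Set.exists_max_image {z ∈ F | z.1 < x} Prod.fst
      (h.finite.subset (Set.sep_subset _ _)) hS
    simp only [Set.mem_ofPred_eq, and_imp, Prod.forall] at hmax hxa
    have hyb := (hx a b hab).1.1 hxa
    have hgt : p.eval a < p.eval x := by
      refine h.eval_lt_eval hx hpos hxa fun c hc a' b' hab' => ?_
      rcases (hne a' b' hab').lt_or_gt with h1 | h1
      · have h2 := (hx a' b' hab').1.1 h1
        have h3 := (hmax a' b' hab' h1).trans_lt hc.1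
        exact ⟨iff_of_true h3 h2, iff_of_false h3.not_gt h2.not_gt⟩
      · have h2 := (hx a' b' hab').2.1 h1
        exact ⟨iff_of_false (hc.2.trans h1).not_gt h2.not_gt, iff_of_true (hc.2.trans h1) h2⟩
    have hqb : q.eval b < 0 := by
      rw [← sign_eq_neg_one_iff, ← h.sign_eval a b hab, sign_eq_neg_one_iff]
      exact hgt.trans_le hp
    have hcell : ∀ y₁, y₁ ≤ y → b < y₁ → SameCell F x y₁ := fun y₁ h₁ h₂ a' b' hab' => by
      rcases (hne a' b' hab').lt_or_gt with h1 | h1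
      · have h3 : b' ≤ b := not_lt.1 fun hb =>
          (hmax a' b' hab' h1).not_gt (((h.iso a b hab) a' b' hab').2.2 hb)
        have h4 := h3.trans_lt h₂
        exact ⟨iff_of_true h1 h4, iff_of_false h1.not_gt h4.not_gt⟩
      · have h3 := h₁.trans_lt ((hx a' b' hab').2.1 h1)
        exact ⟨iff_of_false h1.not_gt h3.not_gt, iff_of_true h1 h3⟩
    rcases lt_or_ge (q.eval y) 0 with hy | hy
    · exact ⟨y, le_rfl, hx, hy⟩
    · obtain ⟨c, hc, hc0⟩ := IsRealClosedField.exists_eval_eq_zero_of_mul_neg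
        (p := q - C (q.eval b / 2)) hyb.le (by
          simp only [eval_sub, eval_C]
          exact mul_neg_of_neg_of_pos (by linarith) (by linarith))
      refine ⟨c, hc.2.le, hcell c hc.2.le hc.1, ?_⟩
      simp only [eval_sub, eval_C] at hc0
      linarith

theorem exists_root_of_pos (h : SeparatesDerivativeRoots F p q) {x : R₁} {y : R₂}
    (hx : SameCell F x y) (hxF : ∀ b, (x, b) ∉ F) (hpos : 0 < p.derivative.eval x)
    (hp : p.eval x = 0) : ∃ z, SameCell F x z ∧ q.eval z = 0 := by
  obtain ⟨y₁, h₁, hx₁, hq₁⟩ := h.exists_ge_eval_pos hx hxF hpos hp.ge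
  obtain ⟨y₀, h₀, hx₀, hq₀⟩ := h.exists_le_eval_neg hx hxF hpos hp.le
  obtain ⟨z, hz, hz0⟩ := IsRealClosedField.exists_eval_eq_zero_of_mul_neg (h₀.trans h₁)
    (mul_neg_of_neg_of_pos hq₀ hq₁)
  exact ⟨z, hx₀.of_mem_Icc_right hx₁ hz.1.le hz.2.le, hz0⟩

theorem exists_root (h : SeparatesDerivativeRoots F p q) {x : R₁} (hp : p.eval x = 0) :
    ∃ z, SameCell F x z ∧ q.eval z = 0 := by
  by_cases hxF : ∃ b, (x, b) ∈ F
  · obtain ⟨b, hb⟩ := hxF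
    refine ⟨b, h.iso x b hb, ?_⟩
    rw [← sign_eq_zero_iff, ← h.sign_eval x b hb, hp, sign_zero]
  · have hp' : p.derivative.eval x ≠ 0 := fun h0 => hxF (h.left_mem x h0)
    rw [not_exists] at hxF
    obtain ⟨y, hy⟩ := SameCell.exists_right h.finite h.iso x
    rcases hp'.lt_or_gt with hlt | hgt
    · simpa using h.neg.exists_root_of_pos hy hxF (by simpa using hlt) (by simpa using hp)
    · exact h.exists_root_of_pos hy hxF hgt hp

/-- The partial isomorphism `F` enlarged by the pairs of roots of `p` and `q` in the same cell. -/
def addRoots (F : Set (R₁ × R₂)) (p : R₁[X]) (q : R₂[X]) : Set (R₁ × R₂) :=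
  F ∪ {z | SameCell F z.1 z.2 ∧ p.eval z.1 = 0 ∧ q.eval z.2 = 0}

theorem subset_addRoots : F ⊆ addRoots F p q := Set.subset_union_left

theorem swap_preimage_addRoots :
    Prod.swap ⁻¹' addRoots F p q = addRoots (Prod.swap ⁻¹' F) q p := by
  ext ⟨y, x⟩
  simp only [addRoots, Set.mem_preimage, Prod.swap_prod_mk, Set.mem_union, Set.mem_ofPred_eq]
  exact or_congr_right ⟨fun h => ⟨h.1.swap, h.2.2, h.2.1⟩, fun h => ⟨h.1.swap, h.2.2, h.2.1⟩⟩

theorem addRoots_neg : addRoots F (-p) (-q) = addRoots F p q := by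
  simp [addRoots]

theorem not_pos_neg_of_derivative_pos (h : SeparatesDerivativeRoots F p q) {x : R₁} {y : R₂}
    (hx : SameCell (addRoots F p q) x y) (hxF : ∀ b, (x, b) ∉ F)
    (hpos : 0 < p.derivative.eval x) (hp : 0 < p.eval x) (hq : q.eval y < 0) : False := by
  have hx' := hx.anti subset_addRoots
  obtain ⟨y₁, h₁, hx₁, hq₁⟩ := h.exists_ge_eval_pos hx' hxF hpos hp.le
  obtain ⟨z, hz, hz0⟩ := IsRealClosedField.exists_eval_eq_zero_of_mul_neg h₁
    (mul_neg_of_neg_of_pos hq hq₁)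
  have hxz := hx'.of_mem_Icc_right hx₁ hz.1.le hz.2.le
  obtain ⟨x₀, hx₀, hp₀⟩ := h.swap.exists_root hz0
  have hlt : x < x₀ := (hx x₀ z (Or.inr ⟨hx₀.swap, hp₀, hz0⟩)).2.2 hz.1
  have := h.eval_lt_eval hxz hpos hlt
    fun c hc => hxz.of_mem_Icc_left hx₀.swap hc.1.le hc.2.le
  linarith

theorem not_pos_neg (h : SeparatesDerivativeRoots F p q) {x : R₁} {y : R₂}
    (hx : SameCell (addRoots F p q) x y) (hp : 0 < p.eval x) (hq : q.eval y < 0) : False := by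
  have hx' := hx.anti subset_addRoots
  by_cases hxF : ∃ b, (x, b) ∈ F
  · obtain ⟨b, hb⟩ := hxF
    obtain rfl := hx'.right_eq hb
    have := h.sign_eval x b hb
    simp [sign_pos hp, sign_neg hq] at this
  · have hp' : p.derivative.eval x ≠ 0 := fun h0 => hxF (h.left_mem x h0)
    rw [not_exists] at hxF
    rcases hp'.lt_or_gt with hlt | hgt
    · have hq' : q.derivative.eval y < 0 := by
        rwa [← sign_eq_neg_one_iff, ← h.sign_derivative x y hx', sign_eq_neg_one_iff]
      refine h.swap.neg.not_pos_neg_of_derivative_pos (x := y) (y := x) ?_ ?_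
        (by simpa using hq') (by simpa using hq) (by simpa using hp)
      · rw [addRoots_neg, ← swap_preimage_addRoots]
        exact hx.swap
      · intro b hb
        exact hxF y (hx'.swap.right_eq hb ▸ hb)
    · exact h.not_pos_neg_of_derivative_pos hx hxF hgt hp hq

theorem eval_eq_zero (h : SeparatesDerivativeRoots F p q) {x : R₁} {y : R₂}
    (hx : SameCell (addRoots F p q) x y) (hp : p.eval x = 0) : q.eval y = 0 := by
  obtain ⟨z, hz, hz0⟩ := h.exists_root hp
  exact hx.right_eq (Or.inr ⟨hz, hp, hz0⟩) ▸ hz0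

theorem sign_eval_eq (h : SeparatesDerivativeRoots F p q) {x : R₁} {y : R₂}
    (hx : SameCell (addRoots F p q) x y) : sign (p.eval x) = sign (q.eval y) := by
  have h₀ := h.eval_eq_zero hx
  have h₀' := h.swap.eval_eq_zero (x := y) (y := x)
    (swap_preimage_addRoots (F := F) ▸ hx.swap)
  have h₁ := h.not_pos_neg hx
  have h₂ := h.neg.not_pos_neg (x := x) (y := y) (by rwa [addRoots_neg])
  simp only [eval_neg, Left.neg_pos_iff, Left.neg_neg_iff] at h₂
  rcases lt_trichotomy (p.eval x) 0 with hp | hp | hp <;>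
    rcases lt_trichotomy (q.eval y) 0 with hq | hq | hq
  · rw [sign_neg hp, sign_neg hq]
  · exact absurd (h₀' hq) hp.ne
  · exact (h₂ hp hq).elim
  · exact absurd (h₀ hp) hq.ne
  · rw [hp, hq, sign_zero, sign_zero]
  · exact absurd (h₀ hp) hq.ne'
  · exact (h₁ hp hq).elim
  · exact absurd (h₀' hq) hp.ne'
  · rw [sign_pos hp, sign_pos hq]

theorem lt_of_lt_of_roots (h : SeparatesDerivativeRoots F p q) {x x' : R₁} {y y' : R₂}
    (hx : SameCell F x y) (hx' : SameCell F x' y') (hp : p.eval x = 0) (hp' : p.eval x' = 0)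
    (hlt : x < x') : y < y' := by
  obtain ⟨c, hc, hc0⟩ := IsRealClosedField.exists_derivative_eq_zero hlt hp hp'
  obtain ⟨b, hb⟩ := h.left_mem c hc0
  exact ((hx c b hb).2.1 hc.1).trans ((hx' c b hb).1.1 hc.2)

theorem iso_addRoots (h : SeparatesDerivativeRoots F p q) (x : R₁) (y : R₂)
    (hxy : (x, y) ∈ addRoots F p q) : SameCell (addRoots F p q) x y := by
  have key : ∀ z ∈ addRoots F p q, SameCell F z.1 z.2 := by
    rintro ⟨a, b⟩ (hab | hab)
    · exact h.iso a b hab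
    · exact hab.1
  rintro a b (hab | hab)
  · exact key _ hxy a b hab
  rcases hxy with hxy | hxy
  · have := hab.1 x y hxy
    exact ⟨this.2, this.1⟩
  · obtain ⟨h₁, hp₁, hq₁⟩ := hab
    obtain ⟨h₂, hp₂, hq₂⟩ := hxy
    exact ⟨⟨h.lt_of_lt_of_roots h₁ h₂ hp₁ hp₂, h.swap.lt_of_lt_of_roots h₁.swap h₂.swap hq₁ hq₂⟩,
      ⟨h.lt_of_lt_of_roots h₂ h₁ hp₂ hp₁, h.swap.lt_of_lt_of_roots h₂.swap h₁.swap hq₂ hq₁⟩⟩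

theorem finite_addRoots (h : SeparatesDerivativeRoots F p q) (hp : p ≠ 0) (hq : q ≠ 0) :
    (addRoots F p q).Finite :=
  h.finite.union <| ((finite_setOfPred_isRoot hp).prod (finite_setOfPred_isRoot hq)).subset
    fun _ hz => ⟨hz.2.1, hz.2.2⟩

end SeparatesDerivativeRoots

theorem IsRealClosedField.exists_mem_uIcc_eval_eq_zero {p : R₁[X]} {a b : R₁}
    (h : sign (p.eval a) ≠ sign (p.eval b)) : ∃ z ∈ Set.uIcc a b, p.eval z = 0 := by
  wlog hab : a ≤ b generalizing a b
  · rw [Set.uIcc_comm]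
    exact this h.symm (le_of_not_ge hab)
  rw [Set.uIcc_of_le hab]
  have key : p.eval a * p.eval b < 0 → ∃ z ∈ Set.Icc a b, p.eval z = 0 := fun h =>
    let ⟨z, hz, hz0⟩ := exists_eval_eq_zero_of_mul_neg hab h
    ⟨z, Set.Ioo_subset_Icc_self hz, hz0⟩
  rcases lt_trichotomy (p.eval a) 0 with ha | ha | ha
  · rcases lt_trichotomy (p.eval b) 0 with hb | hb | hb
    · rw [sign_neg ha, sign_neg hb] at h
      exact absurd rfl h
    · exact ⟨b, Set.right_mem_Icc.2 hab, hb⟩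
    · exact key (mul_neg_of_neg_of_pos ha hb)
  · exact ⟨a, Set.left_mem_Icc.2 hab, ha⟩
  · rcases lt_trichotomy (p.eval b) 0 with hb | hb | hb
    · exact key (mul_neg_of_pos_of_neg ha hb)
    · exact ⟨b, Set.right_mem_Icc.2 hab, hb⟩
    · rw [sign_pos ha, sign_pos hb] at h
      exact absurd rfl h

/-- The finite partial isomorphism `F` contains all roots of the polynomials in the pairs in `W`,
and the components of every such pair have the same signs on corresponding cells. -/
structure IsMatch (W : Set (R₁[X] × R₂[X])) (F : Set (R₁ × R₂)) : Prop where
  finite : F.Finite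
  iso : ∀ a b, (a, b) ∈ F → SameCell F a b
  sign_eq : ∀ w ∈ W, ∀ x y, SameCell F x y → sign (w.1.eval x) = sign (w.2.eval y)
  left_mem : ∀ w ∈ W, w.1 ≠ 0 → ∀ x, w.1.eval x = 0 → ∃ y, (x, y) ∈ F
  right_mem : ∀ w ∈ W, w.2 ≠ 0 → ∀ y, w.2.eval y = 0 → ∃ x, (x, y) ∈ F

namespace IsMatch

variable {W : Set (R₁[X] × R₂[X])} {F : Set (R₁ × R₂)}

theorem swap (h : IsMatch W F) : IsMatch (Prod.swap ⁻¹' W) (Prod.swap ⁻¹' F) where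
  finite := h.finite.preimage Prod.swap_injective.injOn
  iso a b hab := (h.iso b a hab).swap
  sign_eq w hw x y hxy := (h.sign_eq w.swap hw y x hxy.swap).symm
  left_mem w hw := h.right_mem w.swap hw
  right_mem w hw := h.left_mem w.swap hw

theorem snd_eq_zero (h : IsMatch W F) {w : R₁[X] × R₂[X]} (hw : w ∈ W) (h₀ : w.1 = 0) :
    w.2 = 0 := by
  refine Polynomial.funext fun y => ?_
  obtain ⟨x, hx⟩ := SameCell.exists_right h.swap.finite h.swap.iso y
  have := h.sign_eq w hw x y hx.swap
  rw [h₀, eval_zero, sign_zero, eq_comm, sign_eq_zero_iff] at this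
  rw [this, eval_zero]

theorem fst_eq_zero (h : IsMatch W F) {w : R₁[X] × R₂[X]} (hw : w ∈ W) (h₀ : w.2 = 0) :
    w.1 = 0 :=
  h.swap.snd_eq_zero (w := w.swap) hw h₀

theorem restrict (h : IsMatch W F) {W' : Set (R₁[X] × R₂[X])} (hW : W' ⊆ W) :
    IsMatch W' {z ∈ F | ∃ w ∈ W', w.1 ≠ 0 ∧ w.1.eval z.1 = 0} where
  finite := h.finite.subset (Set.sep_subset _ _)
  iso a b hab := (h.iso a b hab.1).anti (Set.sep_subset _ _)
  left_mem w hw hw₀ x hx :=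
    let ⟨y, hy⟩ := h.left_mem w (hW hw) hw₀ x hx
    ⟨y, hy, w, hw, hw₀, hx⟩
  right_mem w hw hw₀ y hy := by
    obtain ⟨x, hx⟩ := h.right_mem w (hW hw) hw₀ y hy
    refine ⟨x, hx, w, hw, mt (h.snd_eq_zero (hW hw)) hw₀, ?_⟩
    rw [← sign_eq_zero_iff, h.sign_eq w (hW hw) x y (h.iso x y hx), hy, sign_zero]
  sign_eq w hw x y hxy := by
    obtain ⟨y₀, hy₀⟩ := SameCell.exists_right h.finite h.iso x
    rw [h.sign_eq w (hW hw) x y₀ hy₀]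
    by_contra hne
    have hw₀ : w.2 ≠ 0 := fun h₀ => hne (by simp [h₀])
    obtain ⟨z, hz, hz₀⟩ := IsRealClosedField.exists_mem_uIcc_eval_eq_zero hne
    obtain ⟨x', hx'⟩ := h.right_mem w (hW hw) hw₀ z hz₀
    have hx'' : (x', z) ∈ {z ∈ F | ∃ w ∈ W', w.1 ≠ 0 ∧ w.1.eval z.1 = 0} := by
      refine ⟨hx', w, hw, mt (h.snd_eq_zero (hW hw)) hw₀, ?_⟩
      rw [← sign_eq_zero_iff, h.sign_eq w (hW hw) x' z (h.iso x' z hx'), hz₀, sign_zero]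
    have hy₀' := hy₀.anti (Set.sep_subset F fun z => ∃ w ∈ W', w.1 ≠ 0 ∧ w.1.eval z.1 = 0)
    have hxz : SameCell {z ∈ F | ∃ w ∈ W', w.1 ≠ 0 ∧ w.1.eval z.1 = 0} x z := by
      rcases Set.mem_uIcc.1 hz with hz | hz
      · exact hy₀'.of_mem_Icc_right hxy hz.1 hz.2
      · exact hxy.of_mem_Icc_right hy₀' hz.1 hz.2
    obtain rfl : x' = x := hxz.swap.right_eq hx''
    obtain rfl := hxy.right_eq hx''
    obtain rfl := hy₀'.right_eq hx''
    exact hne rfl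

theorem insert (h : IsMatch W F) {p : R₁[X]} {q : R₂[X]} (hW : (derivative p, derivative q) ∈ W)
    (hp : derivative p ≠ 0) (hF : ∀ x y, (x, y) ∈ F → sign (p.eval x) = sign (q.eval y))
    (hdeg : p.natDegree = q.natDegree) (hlc : sign p.leadingCoeff = sign q.leadingCoeff) :
    IsMatch (insert (p, q) W) (SeparatesDerivativeRoots.addRoots F p q) := by
  have hq : derivative q ≠ 0 := mt (h.fst_eq_zero hW) hp
  have hs : SeparatesDerivativeRoots F p q :=
    { finite := h.finite
      iso := h.iso
      sign_derivative := h.sign_eq _ hW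
      left_mem := h.left_mem _ hW hp
      right_mem := h.right_mem _ hW hq
      sign_eval := hF
      sign_atTop := by
        obtain ⟨M, hM⟩ := exists_forall_ge_sign_eval p
        obtain ⟨N, hN⟩ := exists_forall_ge_sign_eval q
        exact ⟨_, M, N, hM, hlc ▸ hN⟩
      sign_atBot := by
        obtain ⟨M, hM⟩ := exists_forall_le_sign_eval p
        obtain ⟨N, hN⟩ := exists_forall_le_sign_eval q
        exact ⟨_, M, N, hM, hlc ▸ hdeg ▸ hN⟩ }
  have hp₀ : p ≠ 0 := by
    rintro rfl
    simp at hp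
  have hq₀ : q ≠ 0 := by
    rintro rfl
    simp at hq
  refine ⟨hs.finite_addRoots hp₀ hq₀, hs.iso_addRoots, ?_, ?_, ?_⟩
  · rintro w (rfl | hw) x y hxy
    · exact hs.sign_eval_eq hxy
    · exact h.sign_eq w hw x y (hxy.anti SeparatesDerivativeRoots.subset_addRoots)
  · rintro w (rfl | hw) hw₀ x hx
    · obtain ⟨y, hxy, hy⟩ := hs.exists_root hx
      exact ⟨y, Or.inr ⟨hxy, hx, hy⟩⟩
    · obtain ⟨y, hy⟩ := h.left_mem w hw hw₀ x hx
      exact ⟨y, Or.inl hy⟩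
  · rintro w (rfl | hw) hw₀ y hy
    · obtain ⟨x, hxy, hx⟩ := hs.swap.exists_root hy
      exact ⟨x, Or.inr ⟨hxy.swap, hx, hy⟩⟩
    · obtain ⟨x, hx⟩ := h.right_mem w hw hw₀ y hy
      exact ⟨x, Or.inl hx⟩

end IsMatch

section Elimination

variable {A : Type*} [CommRing A]

theorem Polynomial.exists_pseudo_rem (p u : A[X]) (hu : u.natDegree ≠ 0) :
    ∃ (k : ℕ) (g r : A[X]), C u.leadingCoeff ^ k * p = g * u + r ∧ r.natDegree < u.natDegree := by
  obtain ⟨m, hm⟩ := Nat.exists_eq_succ_of_ne_zero hu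
  suffices h : ∀ (j : ℕ) (p : A[X]), p.natDegree ≤ m + j → ∃ (k : ℕ) (g r : A[X]),
      C u.leadingCoeff ^ k * p = g * u + r ∧ r.natDegree < u.natDegree from
    h p.natDegree p (Nat.le_add_left _ _)
  intro j
  induction j with
  | zero => exact fun p hp => ⟨0, 0, p, by simp, by omega⟩
  | succ j ih =>
    intro p hp
    obtain ⟨k, g, r, h, hr⟩ :=
      ih (C u.leadingCoeff * p - C (p.coeff (m + 1 + j)) * (X ^ j * u)) <| by
        refine natDegree_le_iff_coeff_eq_zero.2 fun N hN => ?_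
        rw [coeff_sub, coeff_C_mul, coeff_C_mul, coeff_X_pow_mul', if_pos (by omega)]
        rcases (show m + 1 + j ≤ N by omega).eq_or_lt with rfl | hlt
        · rw [show m + 1 + j - j = u.natDegree by omega, coeff_natDegree]
          ring
        · rw [coeff_eq_zero_of_natDegree_lt (p := p) (by omega),
            coeff_eq_zero_of_natDegree_lt (p := u) (by omega)]
          ring
    refine ⟨k + 1, g + C u.leadingCoeff ^ k * C (p.coeff (m + 1 + j)) * X ^ j, r, ?_, hr⟩
    linear_combination h

theorem Polynomial.exists_pseudo_rem_even (p u : A[X]) :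
    ∃ r : A[X], r.natDegree ≤ u.natDegree - 1 ∧ (u.natDegree ≠ 0 →
      ∃ (k : ℕ) (g : A[X]), C u.leadingCoeff ^ (2 * k) * p = g * u + r) := by
  by_cases hu : u.natDegree = 0
  · exact ⟨0, by simp, fun h => absurd hu h⟩
  · obtain ⟨k, g, r, h, hr⟩ := exists_pseudo_rem p u hu
    refine ⟨C u.leadingCoeff ^ k * r, ?_, fun _ => ⟨k, C u.leadingCoeff ^ k * g, ?_⟩⟩
    · rw [← C_pow]
      exact (natDegree_C_mul_le _ _).trans (by omega)
    · linear_combination C u.leadingCoeff ^ k * h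

theorem Polynomial.sign_eval_map_eq_of_root {R : Type*} [Field R] [LinearOrder R]
    [IsStrictOrderedRing R] {f : A →+* R} {p g u r : A[X]} {c : A} {k : ℕ} {x : R}
    (h : C c ^ (2 * k) * p = g * u + r) (hc : f c ≠ 0) (hx : (u.map f).eval x = 0) :
    sign ((p.map f).eval x) = sign ((r.map f).eval x) := by
  have h' := congrArg (fun q => (q.map f).eval x) h
  simp only [Polynomial.map_add, Polynomial.map_mul, Polynomial.map_pow, map_C, eval_add, eval_mul,
    eval_pow, eval_C, hx, mul_zero, zero_add] at h'
  have hpos : 0 < f c ^ (2 * k) := by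
    rw [pow_mul]
    positivity
  rw [← h', sign_mul, sign_pos hpos, one_mul]

/-- The homomorphisms `f` and `g` induce the same signs on `T`. -/
def SignAgree (f : A →+* R₁) (g : A →+* R₂) (T : Set A) : Prop :=
  ∀ t ∈ T, sign (f t) = sign (g t)

namespace SignAgree

variable {f : A →+* R₁} {g : A →+* R₂} {T T' : Set A}

theorem anti (h : SignAgree f g T) (hT : T' ⊆ T) : SignAgree f g T' :=
  fun t ht => h t (hT ht)

theorem eq_zero_iff (h : SignAgree f g T) {t : A} (ht : t ∈ T) : f t = 0 ↔ g t = 0 := by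
  rw [← sign_eq_zero_iff, h t ht, sign_eq_zero_iff]

end SignAgree

theorem Polynomial.map_eraseLead_of_eq_zero {B : Type*} [CommRing B] {f : A →+* B} {p : A[X]}
    (h : f p.leadingCoeff = 0) : p.eraseLead.map f = p.map f := by
  rw [← self_sub_monomial_natDegree_leadingCoeff, Polynomial.map_sub, map_monomial, h,
    monomial_zero_right, sub_zero]

variable (R₁ R₂) in
theorem Polynomial.exists_truncations (q : A[X]) :
    ∃ (T : Set A) (U : Set A[X]), T.Finite ∧ U.Finite ∧ (∀ u ∈ U, u.natDegree ≤ q.natDegree) ∧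
      ∀ (f : A →+* R₁) (g : A →+* R₂), SignAgree f g T →
        ∃ u ∈ U, u.map f = q.map f ∧ u.map g = q.map g ∧ (u ≠ 0 → f u.leadingCoeff ≠ 0) := by
  induction hn : q.support.card using Nat.strong_induction_on generalizing q with
  | _ n ih =>
    subst hn
    by_cases hq : q = 0
    · exact ⟨∅, {0}, Set.finite_empty, Set.finite_singleton _, by simp, fun f g _ =>
        ⟨0, rfl, by simp [hq], by simp [hq], fun h => absurd rfl h⟩⟩
    obtain ⟨T, U, hT, hU, hdeg, h⟩ := ih _ (eraseLead_support_card_lt hq) q.eraseLead rfl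
    refine ⟨insert q.leadingCoeff T, insert q U, hT.insert _, hU.insert _, ?_, fun f g hfg => ?_⟩
    · rintro u (rfl | hu)
      · exact le_rfl
      · exact (hdeg u hu).trans (eraseLead_natDegree_le_aux)
    by_cases hlc : f q.leadingCoeff = 0
    · obtain ⟨u, hu, h₁, h₂, h₃⟩ := h f g (hfg.anti (Set.subset_insert _ _))
      have hlc' := (hfg.eq_zero_iff (Set.mem_insert _ _)).1 hlc
      exact ⟨u, Or.inr hu, h₁.trans (map_eraseLead_of_eq_zero hlc),
        h₂.trans (map_eraseLead_of_eq_zero hlc'), h₃⟩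
    · exact ⟨q, Or.inl rfl, rfl, rfl, fun _ => hlc⟩

/-- The pairs of images under `f` and `g` of the polynomials in `Q`. -/
def imagePairs (f : A →+* R₁) (g : A →+* R₂) (Q : Set A[X]) : Set (R₁[X] × R₂[X]) :=
  (fun q => (q.map f, q.map g)) '' Q

variable (R₁ R₂) in
/-- Finitely many sign conditions on the coefficients suffice to match the roots of the images of
the polynomials in `Q`. -/
def Matchable (Q : Set A[X]) : Prop :=
  ∃ T : Set A, T.Finite ∧ ∀ (f : A →+* R₁) (g : A →+* R₂), SignAgree f g T →
    ∃ F, IsMatch (imagePairs f g Q) F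

theorem matchable_of_natDegree_eq_zero {Q : Set A[X]} (hQ : Q.Finite)
    (hdeg : ∀ q ∈ Q, q.natDegree ≤ 0) : Matchable R₁ R₂ Q := by
  refine ⟨(fun q => q.coeff 0) '' Q, hQ.image _, fun f g hfg =>
    ⟨∅, Set.finite_empty, ?_, ?_, ?_, ?_⟩⟩
  · simp
  · rintro _ ⟨q, hq, rfl⟩ x y -
    have := hfg _ ⟨q, hq, rfl⟩
    rw [eq_C_of_natDegree_le_zero (hdeg q hq)]
    simpa using this
  · rintro _ ⟨q, hq, rfl⟩ h₀ x hx
    rw [eq_C_of_natDegree_le_zero (hdeg q hq)] at hx h₀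
    simp only [map_C, eval_C] at hx h₀
    simp [hx] at h₀
  · rintro _ ⟨q, hq, rfl⟩ h₀ x hx
    rw [eq_C_of_natDegree_le_zero (hdeg q hq)] at hx h₀
    simp only [map_C, eval_C] at hx h₀
    simp [hx] at h₀

theorem Matchable.insert {d : ℕ} {p : A[X]} {Q : Set A[X]} (hp : p.natDegree = d + 1)
    (hQ : Q.Finite) (hdeg : ∀ q ∈ Q, q.natDegree ≤ d + 1)
    (ih : ∀ S : Set A[X], S.Finite → (∀ s ∈ S, s.natDegree ≤ d) → Matchable R₁ R₂ (S ∪ Q)) :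
    Matchable R₁ R₂ (insert p Q) := by
  have hp' : (derivative p).natDegree ≤ d := (natDegree_derivative_le p).trans (by omega)
  choose T U hTfin hUfin hUdeg hTU using exists_truncations (A := A) R₁ R₂
  choose rem hrem_deg hrem using exists_pseudo_rem_even p
  set V : Set A[X] := ⋃ q ∈ Insert.insert (derivative p) Q, U q with hV
  have hQ' := hQ.insert (derivative p)
  have hVfin : V.Finite := hQ'.biUnion fun q _ => hUfin q
  obtain ⟨T₁, hT₁, h₁⟩ := ih (Insert.insert (derivative p) (rem '' V))
    ((hVfin.image _).insert _) <| by
    rintro _ (rfl | ⟨u, hu, rfl⟩)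
    · exact hp'
    · simp only [hV, Set.mem_iUnion] at hu
      obtain ⟨q, hq, hu⟩ := hu
      have h1 := hUdeg q u hu
      have h2 : q.natDegree ≤ d + 1 := by
        rcases hq with rfl | hq
        · omega
        · exact hdeg q hq
      have h3 := hrem_deg u
      omega
  obtain ⟨T₂, hT₂, h₂⟩ := ih {p.eraseLead} (Set.finite_singleton _) <| by
    rintro _ rfl
    exact (eraseLead_natDegree_le p).trans (by omega)
  refine ⟨Insert.insert p.leadingCoeff (T₁ ∪ T₂ ∪ (⋃ q ∈ Insert.insert (derivative p) Q, T q) ∪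
    leadingCoeff '' V), (((hT₁.union hT₂).union (hQ'.biUnion fun q _ => hTfin q)).union
      (hVfin.image _)).insert _, fun f g hfg => ?_⟩
  have hlc := hfg.eq_zero_iff (Set.mem_insert _ _)
  by_cases hf : f p.leadingCoeff = 0
  · obtain ⟨F, hF⟩ := h₂ f g (hfg.anti fun t ht => Or.inr (Or.inl (Or.inl (Or.inr ht))))
    refine ⟨F, ?_⟩
    convert hF using 1
    simp only [imagePairs, Set.image_insert_eq, Set.singleton_union,
      map_eraseLead_of_eq_zero hf, map_eraseLead_of_eq_zero (hlc.1 hf)]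
  have hg := mt hlc.2 hf
  obtain ⟨F, hF⟩ := h₁ f g (hfg.anti fun t ht => Or.inr (Or.inl (Or.inl (Or.inl ht))))
  have hF' := hF.restrict (W' := imagePairs f g (Insert.insert (derivative p) Q))
    (Set.image_mono (Set.insert_subset (Or.inl (Or.inl rfl)) Set.subset_union_right))
  refine ⟨_, (hF'.insert (p := p.map f) (q := p.map g) ?_ ?_ ?_ ?_ ?_).restrict ?_⟩
  · exact ⟨derivative p, Or.inl rfl, by simp only [derivative_map]⟩
  · intro h₀
    have := derivative_eq_zero.1 h₀
    rw [natDegree_map_of_leadingCoeff_ne_zero _ hf] at this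
    omega
  · rintro x y hxy
    have hxy' := hF.iso x y hxy.1
    obtain ⟨-, _, ⟨q, hq, rfl⟩, hq₀, hx⟩ := hxy
    have hy : (q.map g).eval y = 0 := by
      have := hF'.sign_eq _ ⟨q, hq, rfl⟩ x y (hxy'.anti (Set.sep_subset _ _))
      rwa [hx, sign_zero, eq_comm, sign_eq_zero_iff] at this
    obtain ⟨u, hu, huf, hug, hu₀⟩ := hTU q f g (hfg.anti fun t ht =>
      Or.inr (Or.inl (Or.inr (Set.mem_biUnion hq ht))))
    have huV : u ∈ V := Set.mem_biUnion hq hu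
    replace hu₀ := hu₀ (by
      rintro rfl
      simp [← huf] at hq₀)
    have hu₁ := mt (hfg.eq_zero_iff (Or.inr (Or.inr ⟨u, huV, rfl⟩))).2 hu₀
    dsimp only at hx
    rw [← huf] at hx
    rw [← hug] at hy
    obtain ⟨k, v, hv⟩ := hrem u fun h₀ => hu₀ (by
      rw [eq_C_of_natDegree_eq_zero h₀] at hx ⊢
      simpa using hx)
    rw [sign_eval_map_eq_of_root hv hu₀ hx, sign_eval_map_eq_of_root hv hu₁ hy]
    exact hF.sign_eq _ ⟨rem u, Or.inl (Or.inr ⟨u, huV, rfl⟩), rfl⟩ x y hxy'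
  · rw [natDegree_map_of_leadingCoeff_ne_zero _ hf, natDegree_map_of_leadingCoeff_ne_zero _ hg]
  · rw [leadingCoeff_map_of_leadingCoeff_ne_zero _ hf,
      leadingCoeff_map_of_leadingCoeff_ne_zero _ hg]
    exact hfg _ (Set.mem_insert _ _)
  · rintro _ ⟨q, rfl | hq, rfl⟩
    · exact Or.inl rfl
    · exact Or.inr ⟨q, Or.inr hq, rfl⟩

theorem Set.Finite.matchable {Q : Set A[X]} (hQ : Q.Finite) : Matchable R₁ R₂ Q := by
  suffices h : ∀ (d : ℕ) (Q : Set A[X]), Q.Finite → (∀ q ∈ Q, q.natDegree ≤ d) →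
      Matchable R₁ R₂ Q by
    obtain ⟨d, hd⟩ := (hQ.image natDegree).bddAbove
    exact h d Q hQ fun q hq => hd ⟨q, hq, rfl⟩
  intro d
  induction d with
  | zero => exact fun Q => matchable_of_natDegree_eq_zero
  | succ d ih =>
    intro Q hQ
    suffices h : (∀ q ∈ Q, q.natDegree ≤ d + 1) → ∀ S : Set A[X], S.Finite →
        (∀ s ∈ S, s.natDegree ≤ d) → Matchable R₁ R₂ (S ∪ Q) from fun hdeg => by
      simpa using h hdeg ∅ Set.finite_empty (by simp)
    induction Q, hQ using Set.Finite.induction_on with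
    | empty => exact fun _ S hS hdeg => by simpa using ih S hS hdeg
    | @insert p Q _ hQ ihQ =>
      intro hdeg S hS hSdeg
      rw [Set.union_insert]
      rw [Set.forall_mem_insert] at hdeg
      rcases hdeg.1.eq_or_lt with hp | hp
      · refine Matchable.insert hp (hS.union hQ) ?_ fun S' hS' hdeg' => ?_
        · rintro q (hq | hq)
          · exact (hSdeg q hq).trans (Nat.le_succ d)
          · exact hdeg.2 q hq
        · rw [← Set.union_assoc]
          refine ihQ hdeg.2 _ (hS'.union hS) ?_
          rintro q (hq | hq)
          · exact hdeg' q hq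
          · exact hSdeg q hq
      · rw [← Set.insert_union]
        exact ihQ hdeg.2 _ (hS.insert p) (Set.forall_mem_insert.2 ⟨Nat.lt_succ_iff.1 hp, hSdeg⟩)

variable (R₁ R₂) in
/-- Elimination of one variable: finitely many sign conditions on the coefficients determine which
sign conditions on the polynomials in `S` can be realized. -/
theorem Set.Finite.exists_sign_conditions {S : Set A[X]} (hS : S.Finite) :
    ∃ T : Set A, T.Finite ∧ ∀ (f : A →+* R₁) (g : A →+* R₂), SignAgree f g T →
      (∀ x, ∃ y, ∀ s ∈ S, sign ((s.map f).eval x) = sign ((s.map g).eval y)) ∧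
      ∀ y, ∃ x, ∀ s ∈ S, sign ((s.map f).eval x) = sign ((s.map g).eval y) := by
  obtain ⟨T, hT, h⟩ := hS.matchable (R₁ := R₁) (R₂ := R₂)
  refine ⟨T, hT, fun f g hfg => ?_⟩
  obtain ⟨F, hF⟩ := h f g hfg
  refine ⟨fun x => ?_, fun y => ?_⟩
  · obtain ⟨y, hy⟩ := SameCell.exists_right hF.finite hF.iso x
    exact ⟨y, fun s hs => hF.sign_eq _ ⟨s, hs, rfl⟩ x y hy⟩
  · obtain ⟨x, hx⟩ := SameCell.exists_right hF.swap.finite hF.swap.iso y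
    exact ⟨x, fun s hs => hF.sign_eq _ ⟨s, hs, rfl⟩ x y hx.swap⟩

end Elimination

section Formulas

open MvPolynomial

/-- The ring homomorphism evaluating integer polynomials at `v`. -/
abbrev MvPolynomial.intEval {γ R : Type*} [CommRing R] (v : γ → R) : MvPolynomial γ ℤ →+* R :=
  eval₂Hom (Int.castRingHom R) v

/-- The integer polynomial defined by a term in the language of rings. -/
def FirstOrder.Ring.polynomialOfTerm {γ : Type*} : Language.ring.Term γ → MvPolynomial γ ℤ
  | .var i => X i
  | .func ringFunc.add ts => polynomialOfTerm (ts 0) + polynomialOfTerm (ts 1)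
  | .func ringFunc.mul ts => polynomialOfTerm (ts 0) * polynomialOfTerm (ts 1)
  | .func ringFunc.neg ts => -polynomialOfTerm (ts 0)
  | .func ringFunc.zero _ => 0
  | .func ringFunc.one _ => 1

theorem FirstOrder.Ring.intEval_polynomialOfTerm {γ R : Type*} [Field R] (v : γ → R)
    (t : Language.ring.Term γ) : intEval v (polynomialOfTerm t) = t.realize v := by
  induction t with
  | var i => exact eval₂Hom_X' _ _ _
  | func f ts ih =>
    cases f with
    | add =>
      rw [polynomialOfTerm, map_add, ih, ih]
      exact (CompatibleRing.funMap_add fun i => (ts i).realize v).symm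
    | mul =>
      rw [polynomialOfTerm, map_mul, ih, ih]
      exact (CompatibleRing.funMap_mul fun i => (ts i).realize v).symm
    | neg =>
      rw [polynomialOfTerm, map_neg, ih]
      exact (CompatibleRing.funMap_neg fun i => (ts i).realize v).symm
    | zero =>
      rw [polynomialOfTerm, map_zero]
      exact (CompatibleRing.funMap_zero _).symm
    | one =>
      rw [polynomialOfTerm, map_one]
      exact (CompatibleRing.funMap_one _).symm

/-- Regards the last variable of an integer polynomial as the indeterminate of a univariate
polynomial. -/
def MvPolynomial.splitLast {γ : Type*} (n : ℕ) :
    MvPolynomial (γ ⊕ Fin (n + 1)) ℤ →+* Polynomial (MvPolynomial (γ ⊕ Fin n) ℤ) :=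
  intEval (Sum.elim (fun i => Polynomial.C (X (Sum.inl i)))
    (Fin.snoc (α := fun _ => Polynomial (MvPolynomial (γ ⊕ Fin n) ℤ))
      (fun i => Polynomial.C (X (Sum.inr i))) Polynomial.X))

theorem MvPolynomial.eval_map_splitLast {γ R : Type*} [CommRing R] {n : ℕ} (v : γ → R)
    (xs : Fin n → R) (x : R) (p : MvPolynomial (γ ⊕ Fin (n + 1)) ℤ) :
    ((splitLast n p).map (intEval (Sum.elim v xs))).eval x =
      intEval (Sum.elim v (Fin.snoc xs x)) p := by
  have : ((Polynomial.evalRingHom x).comp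
      (Polynomial.mapRingHom (intEval (Sum.elim v xs)))).comp (splitLast n) =
      intEval (Sum.elim v (Fin.snoc xs x)) := by
    refine ringHom_ext (by simp [splitLast]) ?_
    rintro (i | i)
    · simp [splitLast]
    · refine Fin.lastCases ?_ (fun i => ?_) i <;> simp [splitLast]
  exact DFunLike.congr_fun this p

variable (R₁ R₂) in
theorem FirstOrder.Ring.exists_signAgree_realize_iff {γ : Type*} {n : ℕ}
    (φ : Language.ring.BoundedFormula γ n) :
    ∃ S : Set (MvPolynomial (γ ⊕ Fin n) ℤ), S.Finite ∧
      ∀ (v : γ → R₁) (xs : Fin n → R₁) (w : γ → R₂) (ys : Fin n → R₂),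
        SignAgree (intEval (Sum.elim v xs)) (intEval (Sum.elim w ys)) S →
          (φ.Realize v xs ↔ φ.Realize w ys) := by
  induction φ with
  | falsum => exact ⟨∅, Set.finite_empty, fun _ _ _ _ _ => Iff.rfl⟩
  | equal t₁ t₂ =>
    refine ⟨{polynomialOfTerm t₁ - polynomialOfTerm t₂}, Set.finite_singleton _,
      fun v xs w ys h => ?_⟩
    have := h.eq_zero_iff (Set.mem_singleton _)
    simpa only [map_sub, sub_eq_zero, intEval_polynomialOfTerm] using! this
  | rel r => cases r
  | imp φ ψ ihφ ihψ =>
    obtain ⟨S, hS, h⟩ := ihφ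
    obtain ⟨T, hT, h'⟩ := ihψ
    exact ⟨S ∪ T, hS.union hT, fun v xs w ys hvw => imp_congr
      (h v xs w ys (hvw.anti Set.subset_union_left))
      (h' v xs w ys (hvw.anti Set.subset_union_right))⟩
  | @all n φ ih =>
    obtain ⟨S, hS, h⟩ := ih
    obtain ⟨T, hT, h'⟩ := (hS.image (splitLast n)).exists_sign_conditions R₁ R₂
    refine ⟨T, hT, fun v xs w ys hvw => ?_⟩
    obtain ⟨hl, hr⟩ := h' _ _ hvw
    simp only [Set.forall_mem_image, eval_map_splitLast] at hl hr
    refine ⟨fun hx y => ?_, fun hy x => ?_⟩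
    · obtain ⟨x, hxy⟩ := hr y
      exact (h _ _ _ _ fun s hs => hxy hs).1 (hx x)
    · obtain ⟨y, hxy⟩ := hl x
      exact (h _ _ _ _ fun s hs => hxy hs).2 (hy y)

end Formulas

end Matching

/-- An embedding of rings in the language of rings, as a ring homomorphism. -/
def FirstOrder.Ring.embeddingToRingHom {R S : Type*} [Field R] [Field S]
    (f : R ↪[Language.ring] S) : R →+* S where
  toFun := f
  map_zero' := by simpa using! f.map_fun zeroFunc ![]
  map_one' := by simpa using! f.map_fun oneFunc ![]
  map_add' x y := by simpa using! f.map_fun addFunc ![x, y]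
  map_mul' x y := by simpa using! f.map_fun mulFunc ![x, y]

theorem IsRealClosedField.sign_map {R S : Type*} [Field R] [IsRealClosedField R] [LinearOrder R]
    [IsStrictOrderedRing R] [Field S] [LinearOrder S] [IsStrictOrderedRing S]
    (f : R →+* S) (x : R) : SignType.sign (f x) = SignType.sign x := by
  obtain ⟨y, rfl | rfl⟩ := IsRealClosedField.sqOrNegSq x <;> by_cases hy : y = 0
  · simp [hy]
  · have h₁ : 0 < y ^ 2 := by positivity
    have h₂ : 0 < f y ^ 2 := by
      have := (map_ne_zero f).2 hy
      positivity
    rw [map_pow, sign_pos h₁, sign_pos h₂]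
  · simp [hy]
  · have h₁ : 0 < y ^ 2 := by positivity
    have h₂ : 0 < f y ^ 2 := by
      have := (map_ne_zero f).2 hy
      positivity
    rw [map_neg, map_pow, Left.sign_neg, Left.sign_neg, sign_pos h₁, sign_pos h₂]

/-- **Model completeness of RCF**: if `R₁`, `R₂` are real closed fields and `R₁` is an
`L`-substructure of `R₂` (witnessed by an embedding `f` in the language of rings), then
`R₁` is an elementary `L`-substructure of `R₂`: every formula of the language of rings
holds of a tuple from `R₁` iff it holds of its image in `R₂`. -/
theorem rcf_model_complete {R₁ R₂ : Type*} [Field R₁] [Field R₂]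
    [IsRealClosedField R₁] [IsRealClosedField R₂]
    (f : R₁ ↪[Language.ring] R₂) (n : ℕ) (φ : Language.ring.Formula (Fin n))
    (x : Fin n → R₁) :
    φ.Realize (⇑f ∘ x) ↔ φ.Realize x := by
  let _ := IsRealClosedField.linearOrder R₁
  let _ := IsRealClosedField.linearOrder R₂
  have := IsRealClosedField.isStrictOrderedRing R₁
  have := IsRealClosedField.isStrictOrderedRing R₂
  obtain ⟨S, -, h⟩ := FirstOrder.Ring.exists_signAgree_realize_iff R₁ R₂ φ
  refine (h x default (f ∘ x) default fun s _ => ?_).symm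
  set g : R₁ →+* R₂ := FirstOrder.Ring.embeddingToRingHom f
  have hg : MvPolynomial.intEval (Sum.elim (f ∘ x) (default : Fin 0 → R₂)) =
      g.comp (MvPolynomial.intEval (Sum.elim x (default : Fin 0 → R₁))) := by
    refine MvPolynomial.ringHom_ext (by simp) ?_
    rintro (i | i)
    · simp [g, FirstOrder.Ring.embeddingToRingHom]
    · exact i.elim0
  rw [hg, RingHom.comp_apply, IsRealClosedField.sign_map]
end
end

section
/- Let R be a real closed field and X ⊂ Rⁿ an algebraic set. Then the real dimension dim_R(X) is L_R-definable, where L_R := L ∪ {c_i}_{i∈R} is the language of rings extended with constant symbols for all elements of R: for each d, the condition dim_R(X) = d can be expressed by an L_R-sentence built from a finite set of generators of the vanishing ideal 𝓘(X), using that for an irreducible algebraic set X with 𝓘(X)=(p₁,…,p_ℓ), dim_R(X) = max{ d ∈ {1,…,n} : ∃x∈X with rk([∂p_s/∂x_t(x)]) = n − d }. -/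
universe u

noncomputable section

open FirstOrder Language

/-- Left-associated power `a^n` in a possibly non-associative ring:
`npw a 0 = 1`, `npw a (n+1) = npw a n * a`. -/
def npw {D : Type*} [One D] [Mul D] (a : D) : ℕ → D
  | 0 => 1
  | n + 1 => npw a n * a

/-- The center of a possibly non-associative ring:
elements that associate and commute with all other elements. -/
def centerSet (D : Type*) [Mul D] : Set D :=
  {a : D | ∀ b c : D, (a * b) * c = a * (b * c) ∧ a * (b * c) = (c * a) * b}

/-- A (possibly non-associative) ring is alternative if `a(ab) = (aa)b` and `(ab)b = a(bb)`. -/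
def IsAlternative (D : Type*) [Mul D] : Prop :=
  ∀ a b : D, a * (a * b) = (a * a) * b ∧ (a * b) * b = a * (b * b)

/-- A (possibly non-associative) ring is a division ring if for all `a ≠ 0` and all `b`
there are unique `c`, `d` with `a*c = b` and `d*a = b`. -/
def IsDivRing (D : Type*) [Mul D] [Zero D] : Prop :=
  ∀ a b : D, a ≠ 0 → (∃! c : D, a * c = b) ∧ (∃! d : D, d * a = b)

/-- Axiom (H2): centrally finite of dimension 4, i.e. there is a basis `{1, i, j, k}`
over the center. -/
def IsCentrallyFinite4 (H : Type*) [NonAssocRing H] : Prop :=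
  ∃ i j k : H,
    (∀ l1 li lj lk : H, l1 ∈ centerSet H → li ∈ centerSet H → lj ∈ centerSet H →
      lk ∈ centerSet H → l1 + li * i + lj * j + lk * k = 0 →
        l1 = 0 ∧ li = 0 ∧ lj = 0 ∧ lk = 0) ∧
    (∀ q : H, ∃ l1 li lj lk : H, l1 ∈ centerSet H ∧ li ∈ centerSet H ∧ lj ∈ centerSet H ∧
      lk ∈ centerSet H ∧ q = l1 + li * i + lj * j + lk * k)

/-- Axiom (O2): centrally finite of dimension 8, i.e. there is a basis `{1, e₁, …, e₇}`
over the center. -/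
def IsCentrallyFinite8 (O : Type*) [NonAssocRing O] : Prop :=
  ∃ e : Fin 7 → O,
    (∀ (l0 : O) (l : Fin 7 → O), l0 ∈ centerSet O → (∀ h, l h ∈ centerSet O) →
      l0 + ∑ h, l h * e h = 0 → l0 = 0 ∧ ∀ h, l h = 0) ∧
    (∀ q : O, ∃ (l0 : O) (l : Fin 7 → O), l0 ∈ centerSet O ∧ (∀ h, l h ∈ centerSet O) ∧
      q = l0 + ∑ h, l h * e h)

/-- A (possibly non-associative) ring is algebraically closed if every nonconstant
polynomial with coefficients in the center has a root. -/
def IsAlgebraicallyClosedDiv (D : Type*) [NonAssocRing D] : Prop :=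
  ∀ d : ℕ, 1 ≤ d → ∀ a : ℕ → D, (∀ h, a h ∈ centerSet D) → a d ≠ 0 →
    ∃ b : D, ∑ h ∈ Finset.range (d + 1), a h * npw b h = 0

/-- A model of ACQ: an algebraically closed quaternion algebra. -/
structure ACQModel (H : Type*) [NonAssocRing H] : Prop where
  nontrivial : (1 : H) ≠ 0
  alt : IsAlternative H
  div : IsDivRing H
  dim4 : IsCentrallyFinite4 H
  algClosed : IsAlgebraicallyClosedDiv H

/-- A model of ACO: an algebraically closed octonion algebra. -/
structure ACOModel (O : Type*) [NonAssocRing O] : Prop where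
  nontrivial : (1 : O) ≠ 0
  alt : IsAlternative O
  div : IsDivRing O
  dim8 : IsCentrallyFinite8 O
  algClosed : IsAlgebraicallyClosedDiv O

/-- The common zero set of a finite family of polynomials. -/
def realZeroSet {R : Type*} [CommRing R] {ι : Type*} {k : ℕ}
    (p : Fin k → MvPolynomial ι R) : Set (ι → R) :=
  {x | ∀ s, MvPolynomial.eval x (p s) = 0}

/-- A real algebraic set: the common zero set of finitely many polynomials. -/
def IsRealAlgebraicSet {R : Type*} [CommRing R] {ι : Type*} (X : Set (ι → R)) : Prop :=
  ∃ (k : ℕ) (p : Fin k → MvPolynomial ι R), X = realZeroSet p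

/-- The ideal of polynomials vanishing on a set `X ⊆ R^ι`. -/
def vanishIdeal {R : Type*} [CommRing R] {ι : Type*} (X : Set (ι → R)) :
    Ideal (MvPolynomial ι R) where
  carrier := {p | ∀ x ∈ X, MvPolynomial.eval x p = 0}
  add_mem' := by
    intro a b ha hb x hx
    simp [map_add, ha x hx, hb x hx]
  zero_mem' := by
    intro x hx
    simp
  smul_mem' := by
    intro c p hp x hx
    simp [smul_eq_mul, map_mul, hp x hx]

/-- The dimension of a set `X ⊆ R^ι`: the Krull dimension of the quotient of the
polynomial ring by the vanishing ideal of `X`. -/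
noncomputable def realDim {R : Type*} [CommRing R] {ι : Type*} (X : Set (ι → R)) :
    WithBot (WithTop ℕ) :=
  ringKrullDim (MvPolynomial ι R ⧸ vanishIdeal X)

attribute [local instance] FirstOrder.Ring.compatibleRingOfRing

universe v w

/-- An injective integral ring extension preserves the Krull dimension. -/
theorem ringKrullDim_eq_of_isIntegral_of_injective (R S : Type*) [CommRing R] [CommRing S]
    [Algebra R S] [Algebra.IsIntegral R S]
    (hinj : Function.Injective (algebraMap R S)) :
    ringKrullDim S = ringKrullDim R := by
  refine le_antisymm ?_ ?_
  · refine Order.krullDim_le_of_strictMono (PrimeSpectrum.comap (algebraMap R S)) fun P Q h ↦ ?_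
    exact Ideal.IsIntegral.comap_lt_comap h
  · refine iSup_le fun l ↦ ?_
    have : FaithfulSMul R S := (faithfulSMul_iff_algebraMap_injective R S).mpr hinj
    obtain ⟨Q, hQ⟩ := Algebra.IsIntegral.comap_surjective R S l.head
    have lo : Q.asIdeal.LiesOver l.head.asIdeal := ⟨by rw [← hQ]; rfl⟩
    obtain ⟨L, hL, -⟩ := Ideal.exists_ltSeries_of_hasGoingUp l Q.asIdeal
    exact hL ▸ le_iSup (fun L : LTSeries (PrimeSpectrum S) ↦ (L.length : WithBot ℕ∞)) L

/-- The Krull dimension of a finitely generated domain over a field is its transcendence degree. -/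
theorem exists_ringKrullDim_eq_and_trdeg_eq (K A : Type u) [Field K] [CommRing A] [IsDomain A]
    [Algebra K A] [Algebra.FiniteType K A] :
    ∃ s : ℕ, ringKrullDim A = s ∧ Algebra.trdeg K A = s := by
  obtain ⟨s, g, hinj, hint⟩ := exists_integral_inj_algHom_of_fg K A
  algebraize [g.toRingHom]
  have hinj' : Function.Injective (algebraMap (MvPolynomial (Fin s) K) A) := hinj
  have : FaithfulSMul (MvPolynomial (Fin s) K) A :=
    (faithfulSMul_iff_algebraMap_injective _ _).mpr hinj'
  have : Algebra.IsIntegral (MvPolynomial (Fin s) K) A := ⟨hint⟩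
  have : IsScalarTower K (MvPolynomial (Fin s) K) A := .of_algHom g
  refine ⟨s, ?_, ?_⟩
  · rw [ringKrullDim_eq_of_isIntegral_of_injective (MvPolynomial (Fin s) K) A hinj']
    simp
  · rw [← trdeg_add_eq K (MvPolynomial (Fin s) K),
      trdeg_eq_zero (R := MvPolynomial (Fin s) K)]
    simp

/-- A family in an algebra over a field which is algebraically independent remains so modulo a
suitable prime ideal. -/
theorem AlgebraicIndependent.exists_isPrime {K A ι : Type*} [Field K] [CommRing A] [Algebra K A]
    {x : ι → A} (hx : AlgebraicIndependent K x) :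
    ∃ P : Ideal A, P.IsPrime ∧ AlgebraicIndependent K fun i ↦ Ideal.Quotient.mk P (x i) := by
  obtain ⟨P, hP, hcomap⟩ := Ideal.exists_comap_eq_of_mem_minimalPrimes_of_injective
    (f := (MvPolynomial.aeval x : MvPolynomial ι K →ₐ[K] A).toRingHom) hx ⊥
    (by simp [IsDomain.minimalPrimes_eq_singleton_bot])
  refine ⟨P, hP, ?_⟩
  rw [algebraicIndependent_iff]
  intro p hp
  have : MvPolynomial.aeval x p ∈ P := by
    rw [← Ideal.Quotient.eq_zero_iff_mem, ← hp, ← Ideal.Quotient.mkₐ_eq_mk K,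
      ← AlgHom.comp_apply, MvPolynomial.comp_aeval]
  rw [← Ideal.mem_bot, ← hcomap]
  exact this

/-- A finite generating family of a domain over a field contains algebraically independent
subfamilies of any size up to the transcendence degree. -/
theorem exists_algebraicIndependent_comp_of_adjoin_eq_top {K A : Type u} {ι : Type*} [Field K]
    [CommRing A] [IsDomain A] [Algebra K A] {y : ι → A}
    (hy : Algebra.adjoin K (Set.range y) = ⊤) {d : ℕ} (hd : (d : Cardinal) ≤ Algebra.trdeg K A) :
    ∃ e : Fin d → ι, AlgebraicIndependent K (y ∘ e) := by
  have : Algebra.IsIntegral (Algebra.adjoin K (Set.range y)) A :=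
    Algebra.isIntegral_of_surjective fun a ↦ ⟨⟨a, hy ▸ trivial⟩, rfl⟩
  obtain ⟨t, hts, ht⟩ := exists_isTranscendenceBasis_subset (R := K) (Set.range y)
  have hle : Cardinal.lift.{u} (Cardinal.mk (Fin d)) ≤ Cardinal.lift.{0} (Cardinal.mk t) := by
    rw [ht.cardinalMk_eq_trdeg]
    simpa using hd
  obtain ⟨j⟩ := Cardinal.lift_mk_le'.mp hle
  choose e he using fun i ↦ hts (j i).2
  refine ⟨e, ?_⟩
  rw [show y ∘ e = Subtype.val ∘ j from funext he]
  exact ht.1.comp j j.injective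

/-- The Krull dimension of a finitely generated algebra over a field is at least `d` if and only if
some `d` of the given generators are algebraically independent. -/
theorem le_ringKrullDim_iff_exists_algebraicIndependent {K B : Type u} [Field K] [CommRing B]
    [Algebra K B] {n : ℕ} {x : Fin n → B} (hx : Algebra.adjoin K (Set.range x) = ⊤) (d : ℕ) :
    (d : WithBot ℕ∞) ≤ ringKrullDim B ↔ ∃ e : Fin d → Fin n, AlgebraicIndependent K (x ∘ e) := by
  have : Algebra.FiniteType K B :=
    ⟨⟨(Set.finite_range x).toFinset, by rwa [Set.Finite.coe_toFinset]⟩⟩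
  constructor
  · intro h
    obtain ⟨l, hl⟩ := Order.le_krullDim_iff.mp h
    set P := l.head.asIdeal
    obtain ⟨s, hs, htr⟩ := exists_ringKrullDim_eq_and_trdeg_eq K (B ⧸ P)
    have hd : (d : WithBot ℕ∞) ≤ ringKrullDim (B ⧸ P) := by
      rw [ringKrullDim_quotient, Order.le_krullDim_iff]
      exact ⟨⟨l.length, fun i ↦ ⟨l i, l.head_le i⟩, fun i ↦ l.step i⟩, hl⟩
    have hds : d ≤ s := by rw [hs] at hd; exact_mod_cast hd
    have hy : Algebra.adjoin K (Set.range (Ideal.Quotient.mkₐ K P ∘ x)) = ⊤ := by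
      rw [Set.range_comp, ← AlgHom.map_adjoin, hx, Algebra.map_top, AlgHom.range_eq_top]
      exact Ideal.Quotient.mk_surjective
    obtain ⟨e, he⟩ := exists_algebraicIndependent_comp_of_adjoin_eq_top hy (d := d)
      (by rw [htr]; exact_mod_cast hds)
    exact ⟨e, .of_comp (Ideal.Quotient.mkₐ K P) he⟩
  · rintro ⟨e, he⟩
    obtain ⟨P, hP, hind⟩ := he.exists_isPrime
    obtain ⟨s, hs, htr⟩ := exists_ringKrullDim_eq_and_trdeg_eq K (B ⧸ P)
    refine le_trans ?_ (ringKrullDim_quotient_le P)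
    have := hind.lift_cardinalMk_le_trdeg
    rw [htr] at this
    rw [hs]
    simpa using this

/-- The Krull dimension of an affine algebra is at least `d` if and only if some `d` of the
coordinate functions are algebraically independent. -/
theorem le_ringKrullDim_quotient_iff {K : Type u} [Field K] {n : ℕ}
    (I : Ideal (MvPolynomial (Fin n) K)) (d : ℕ) :
    (d : WithBot ℕ∞) ≤ ringKrullDim (MvPolynomial (Fin n) K ⧸ I) ↔
      ∃ e : Fin d → Fin n, AlgebraicIndependent K
        fun i ↦ Ideal.Quotient.mk I (MvPolynomial.X (e i)) := by
  refine le_ringKrullDim_iff_exists_algebraicIndependent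
    (x := Ideal.Quotient.mkₐ K I ∘ MvPolynomial.X) ?_ d
  rw [Set.range_comp, ← AlgHom.map_adjoin, MvPolynomial.adjoin_range_X, Algebra.map_top,
    AlgHom.range_eq_top]
  exact Ideal.Quotient.mk_surjective

/-- If `α ∘ φ = β ∘ f` with `α` injective into a domain, then `ker φ` lies in the image of
`Spec f`. -/
theorem ker_mem_range_comap_of_comp_eq {B S E Ω : Type*} [CommRing B] [CommRing S] [CommRing E]
    [IsDomain E] [CommRing Ω] [IsDomain Ω] {f : B →+* S} {φ : B →+* E} {α : E →+* Ω}
    (hα : Function.Injective α) {β : S →+* Ω} (h : α.comp φ = β.comp f) :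
    (⟨RingHom.ker φ, RingHom.ker_isPrime φ⟩ : PrimeSpectrum B) ∈
      Set.range (PrimeSpectrum.comap f) := by
  refine ⟨⟨RingHom.ker β, RingHom.ker_isPrime β⟩, ?_⟩
  ext x
  have := congr($h x)
  simp only [RingHom.comp_apply] at this
  simp [← this, map_eq_zero_iff α hα]

open TensorProduct in
/-- If `ker φ` lies in the image of `Spec f`, then `φ` and `f` can be completed to a commutative
square with values in a field, by homomorphisms of which the one completing `φ` is injective. -/
theorem exists_comp_eq_of_ker_mem_range_comap {B : Type*} {S : Type v} {E : Type w} [CommRing B]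
    [CommRing S] [CommRing E] [IsDomain E] {f : B →+* S} {φ : B →+* E}
    (h : (⟨RingHom.ker φ, RingHom.ker_isPrime φ⟩ : PrimeSpectrum B) ∈
      Set.range (PrimeSpectrum.comap f)) :
    ∃ (Ω : Type (max v w)) (_ : Field Ω) (α : E →+* Ω) (β : S →+* Ω),
      Function.Injective α ∧ α.comp φ = β.comp f := by
  obtain ⟨q, hq⟩ := h
  have hq' : RingHom.ker φ = q.asIdeal.comap f := congrArg PrimeSpectrum.asIdeal hq.symm
  set p := RingHom.ker φ with hp
  have : p.IsPrime := RingHom.ker_isPrime φ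
  let i : p.ResidueField →+* FractionRing E :=
    Ideal.ResidueField.lift p ((algebraMap E (FractionRing E)).comp φ)
      (fun x (hx : φ x = 0) ↦ by simp [hx])
      fun x (hx : φ x ≠ 0) ↦ IsUnit.mk0 _ <| by simpa using hx
  let j : p.ResidueField →+* q.asIdeal.ResidueField := Ideal.ResidueField.map p q.asIdeal f hq'
  algebraize [i, j]
  obtain ⟨m, hm⟩ :=
    Ideal.exists_maximal (FractionRing E ⊗[p.ResidueField] q.asIdeal.ResidueField)
  let π := Ideal.Quotient.mk m
  let _ : Field (_ ⧸ m) := Ideal.Quotient.field m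
  let α : FractionRing E →+* _ ⧸ m := π.comp Algebra.TensorProduct.includeLeftRingHom
  refine ⟨_ ⧸ m, inferInstance, α.comp (algebraMap E (FractionRing E)),
    (π.comp Algebra.TensorProduct.includeRight.toRingHom).comp
      (algebraMap S q.asIdeal.ResidueField),
    α.injective.comp (IsFractionRing.injective E (FractionRing E)), ?_⟩
  have h := Algebra.TensorProduct.includeLeftRingHom_comp_algebraMap (R := p.ResidueField)
    (A := FractionRing E) (B := q.asIdeal.ResidueField)
  ext x
  have hi : i (algebraMap B p.ResidueField x) = algebraMap E (FractionRing E) (φ x) :=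
    Ideal.ResidueField.lift_algebraMap ..
  have hj : j (algebraMap B p.ResidueField x) = algebraMap S _ (f x) :=
    Ideal.ResidueField.map_algebraMap ..
  have := congr(π ($h (algebraMap B p.ResidueField x)))
  simp only [RingHom.comp_apply, RingHom.algebraMap_toAlgebra, hi, hj] at this
  exact this

/-- For a family of affine algebras over a base ring `A`, algebraic independence of coordinate
functions on the fibre over a field-valued point `φ` is read off from the image of a map between
spectra that does not depend on `φ`. -/
theorem algebraicIndependent_mk_map_iff {A K ι δ : Type*} [CommRing A] [Field K]
    (I : Ideal (MvPolynomial ι A)) (φ : A →+* K) (e : δ → ι) :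
    AlgebraicIndependent K (fun i ↦
        Ideal.Quotient.mk (I.map (MvPolynomial.map φ)) (MvPolynomial.X (e i))) ↔
      (⟨RingHom.ker (MvPolynomial.map φ : MvPolynomial δ A →+* MvPolynomial δ K),
          RingHom.ker_isPrime _⟩ : PrimeSpectrum (MvPolynomial δ A)) ∈
        Set.range (PrimeSpectrum.comap (MvPolynomial.aeval (R := A) fun i ↦
          Ideal.Quotient.mk I (MvPolynomial.X (e i))).toRingHom) := by
  constructor
  · intro h
    obtain ⟨P, hP, hind⟩ := h.exists_isPrime
    refine ker_mem_range_comap_of_comp_eq (α := (MvPolynomial.aeval _).toRingHom) hind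
      (β := (Ideal.Quotient.mk P).comp
        (Ideal.quotientMap _ (MvPolynomial.map φ) Ideal.le_comap_map)) ?_
    refine MvPolynomial.ringHom_ext (fun a ↦ ?_) fun i ↦ ?_
    · simp
      rfl
    · simp
  · intro h
    obtain ⟨Ω, _, α, β, hα, h⟩ := exists_comp_eq_of_ker_mem_range_comap h
    let := (α.comp MvPolynomial.C).toAlgebra
    let y : ι → Ω := fun i ↦ β (Ideal.Quotient.mk I (MvPolynomial.X i))
    have hC (a : A) : α (MvPolynomial.C (φ a)) = β (Ideal.Quotient.mk I (MvPolynomial.C a)) := by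
      have h' : Ideal.Quotient.mk I (MvPolynomial.C a) = algebraMap A _ a := rfl
      have := congr($h (MvPolynomial.C a))
      simpa [h'] using this
    have hX (i : δ) : α (MvPolynomial.X i) = y (e i) := by
      have := congr($h (MvPolynomial.X i))
      simpa using this
    have hcomp : (MvPolynomial.aeval (R := K) y).toRingHom.comp (MvPolynomial.map φ) =
        β.comp (Ideal.Quotient.mk I) := by
      refine MvPolynomial.ringHom_ext (fun a ↦ ?_) fun i ↦ ?_
      · simp [← hC, RingHom.algebraMap_toAlgebra]
      · simp [y]
    have hker : ∀ g ∈ I.map (MvPolynomial.map φ), MvPolynomial.aeval (R := K) y g = 0 := by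
      suffices I.map (MvPolynomial.map φ) ≤ RingHom.ker (MvPolynomial.aeval (R := K) y) from
        fun g hg ↦ this hg
      rw [Ideal.map_le_iff_le_comap]
      intro g hg
      have := congr($hcomp g)
      rw [RingHom.comp_apply, RingHom.comp_apply, Ideal.Quotient.eq_zero_iff_mem.mpr hg,
        map_zero] at this
      exact this
    refine .of_comp (Ideal.Quotient.liftₐ _ (MvPolynomial.aeval (R := K) y) hker) ?_
    have hαe : (MvPolynomial.aeval (R := K) (y ∘ e)).toRingHom = α :=
      MvPolynomial.ringHom_ext (fun a ↦ by simp [RingHom.algebraMap_toAlgebra])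
        fun i ↦ by simp [hX]
    have : AlgebraicIndependent K (y ∘ e) := by
      rw [← hαe] at hα
      exact hα
    convert this using 1
    ext i
    exact MvPolynomial.aeval_X y (e i)

/-- The homomorphisms from a polynomial ring to a finitely presented algebra are of finite
presentation. -/
theorem finitePresentation_aeval {A S : Type*} [CommRing A] [CommRing S] [Algebra A S]
    [Algebra.FinitePresentation A S] {δ : Type*} [Finite δ] (x : δ → S) :
    (MvPolynomial.aeval (R := A) x).toRingHom.FinitePresentation := by
  algebraize [(MvPolynomial.aeval (R := A) x).toRingHom]
  have : IsScalarTower A (MvPolynomial δ A) S := .of_algHom (MvPolynomial.aeval x)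
  exact Algebra.FinitePresentation.of_restrict_scalars_finitePresentation A (MvPolynomial δ A) S

section Definability

/-- The homomorphism `ℤ[κ] → K` given by a point of `K^κ`. -/
abbrev intEvalHom {κ K : Type*} [CommRing K] (c : κ → K) : MvPolynomial κ ℤ →+* K :=
  MvPolynomial.eval₂Hom (Int.castRingHom K) c

variable {κ K : Type*} [Field K] [FirstOrder.Ring.CompatibleRing K]

/-- The zero set of a polynomial with integer coefficients is definable. -/
theorem definable_setOf_intEvalHom_eq_zero (T : Set K) (a : MvPolynomial κ ℤ) :
    T.Definable Language.ring {c : κ → K | intEvalHom c a = 0} := by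
  refine Set.Definable.mono (A := ∅) ?_ (Set.empty_subset T)
  rw [Set.empty_definable_iff]
  refine ⟨Language.Term.equal
    (FirstOrder.Ring.termOfFreeCommRing ((freeCommRingEquivMvPolynomialInt κ).symm a)) 0, ?_⟩
  ext c
  have : (FreeCommRing.lift c).comp (freeCommRingEquivMvPolynomialInt κ).symm.toRingHom =
      intEvalHom c := by
    ext <;> simp [freeCommRingEquivMvPolynomialInt]
  rw [Set.mem_ofPred_eq, ← this]
  simp [Language.Formula.Realize, Language.Term.equal]

/-- The vanishing of a polynomial depending on parameters is a definable condition. -/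
theorem definable_setOf_map_intEvalHom_eq_zero {δ : Type*} (T : Set K)
    (g : MvPolynomial δ (MvPolynomial κ ℤ)) :
    T.Definable Language.ring {c : κ → K | MvPolynomial.map (intEvalHom c) g = 0} := by
  have : {c : κ → K | MvPolynomial.map (intEvalHom c) g = 0} =
      ⋂ m ∈ g.support, {c : κ → K | intEvalHom c (g.coeff m) = 0} := by
    ext c
    simp only [Set.mem_ofPred_eq, Set.mem_iInter, MvPolynomial.ext_iff, MvPolynomial.coeff_map,
      MvPolynomial.coeff_zero]
    refine forall_congr' fun m ↦ ⟨fun h _ ↦ h, fun h ↦ ?_⟩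
    by_cases hm : m ∈ g.support
    · exact h hm
    · simp [MvPolynomial.notMem_support_iff.mp hm]
  rw [this]
  exact Set.definable_biInter_finset (fun m ↦ definable_setOf_intEvalHom_eq_zero T _) _

/-- The points whose fibres meet a constructible set form a definable set. -/
theorem definable_setOf_ker_map_mem {δ : Type*} (T : Set K)
    {Z : Set (PrimeSpectrum (MvPolynomial δ (MvPolynomial κ ℤ)))}
    (hZ : Topology.IsConstructible Z) :
    T.Definable Language.ring {c : κ → K |
      (⟨RingHom.ker (MvPolynomial.map (intEvalHom c)), RingHom.ker_isPrime _⟩ :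
        PrimeSpectrum (MvPolynomial δ (MvPolynomial κ ℤ))) ∈ Z} := by
  obtain ⟨D, rfl⟩ := PrimeSpectrum.exists_constructibleSetData_iff.mpr hZ
  simp only [PrimeSpectrum.ConstructibleSetData.toSet, Set.mem_iUnion, Set.ofPred_exists]
  refine Set.definable_biUnion_finset (fun C ↦ ?_) D
  have : {c : κ → K | (⟨RingHom.ker (MvPolynomial.map (intEvalHom c)), RingHom.ker_isPrime _⟩ :
        PrimeSpectrum (MvPolynomial δ (MvPolynomial κ ℤ))) ∈ C.toSet} =
      (⋂ i, {c | MvPolynomial.map (intEvalHom c) (C.g i) = 0}) \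
        {c | MvPolynomial.map (intEvalHom c) C.f = 0} := by
    ext c
    simp [PrimeSpectrum.BasicConstructibleSetData.toSet, PrimeSpectrum.mem_zeroLocus,
      Set.range_subset_iff]
  rw [this]
  exact (Set.definable_iInter_of_finite fun i ↦ definable_setOf_map_intEvalHom_eq_zero T _).sdiff
    (definable_setOf_map_intEvalHom_eq_zero T _)

/-- In a family of affine algebras parametrized by the points `c` of an affine space, the set of
`c` for which the dimension of the fibre is at least `d` is definable. -/
theorem definable_setOf_le_ringKrullDim (T : Set K) {n : ℕ}
    {I : Ideal (MvPolynomial (Fin n) (MvPolynomial κ ℤ))} (hI : I.FG) (d : ℕ) :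
    T.Definable Language.ring {c : κ → K | (d : WithBot ℕ∞) ≤
      ringKrullDim (MvPolynomial (Fin n) K ⧸ I.map (MvPolynomial.map (intEvalHom c)))} := by
  have := Algebra.FinitePresentation.quotient (R := MvPolynomial κ ℤ) hI
  simp only [le_ringKrullDim_quotient_iff, algebraicIndependent_mk_map_iff, Set.ofPred_exists]
  exact Set.definable_iUnion_of_finite fun e ↦ definable_setOf_ker_map_mem T
    (PrimeSpectrum.isConstructible_range_comap (finitePresentation_aeval _))

/-- In a family of affine algebras parametrized by the points `c` of an affine space, the set of
`c` for which the dimension of the fibre is `d` is definable. -/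
theorem definable_setOf_ringKrullDim_eq (T : Set K) {n : ℕ}
    {I : Ideal (MvPolynomial (Fin n) (MvPolynomial κ ℤ))} (hI : I.FG) (d : ℕ) :
    T.Definable Language.ring {c : κ → K |
      ringKrullDim (MvPolynomial (Fin n) K ⧸ I.map (MvPolynomial.map (intEvalHom c))) = d} := by
  convert (definable_setOf_le_ringKrullDim T hI d).sdiff
    (definable_setOf_le_ringKrullDim T hI (d + 1)) using 1
  ext c
  simp only [Set.mem_ofPred_eq, Set.mem_sdiff, not_le]
  generalize ringKrullDim
    (MvPolynomial (Fin n) K ⧸ I.map (MvPolynomial.map (intEvalHom c))) = x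
  induction x using WithBot.recBotCoe with
  | bot => simp
  | coe x =>
    induction x using ENat.recTopCoe with
    | top => simpa using fun h ↦ ENat.natCast_ne_top d (WithBot.coe_injective h).symm
    | coe x =>
      norm_cast
      omega

end Definability

/-- The general polynomial of degree at most `D`. -/
def generalPoly {σ ι : Type*} [Finite σ] (D : ℕ) (s : ι) :
    MvPolynomial σ (MvPolynomial (ι × (σ →₀ ℕ)) ℤ) :=
  ∑ m ∈ (Finsupp.finite_of_degree_le D).toFinset, MvPolynomial.monomial m (MvPolynomial.X (s, m))

/-- Every polynomial of degree at most `D` is a specialization of the general one. -/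
theorem map_generalPoly {σ ι R : Type*} [Finite σ] [CommRing R] {D : ℕ}
    {p : ι → MvPolynomial σ R} {s : ι} (hs : (p s).totalDegree ≤ D) :
    MvPolynomial.map (intEvalHom fun q : ι × (σ →₀ ℕ) ↦ (p q.1).coeff q.2) (generalPoly D s) =
      p s := by
  classical
  ext m
  simp only [generalPoly, map_sum, MvPolynomial.map_monomial, MvPolynomial.coeff_sum,
    MvPolynomial.coeff_monomial, Finset.sum_ite_eq', Set.Finite.mem_toFinset]
  split_ifs with hm
  · simp
  · refine (MvPolynomial.coeff_eq_zero_of_totalDegree_lt ?_).symm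
    exact hs.trans_lt (lt_of_not_ge fun h ↦ hm h)

/-- **The real dimension of an algebraic set is `L_R`-definable**: for every number of
variables `n`, number of generators `ℓ`, degree bound `D` and every candidate dimension
`d`, there is a formula of the language of rings with parameters from `R` (with free
variables for the coefficients of the generators) such that for every algebraic set
`X ⊆ Rⁿ` whose vanishing ideal is generated by polynomials `p₁, …, p_ℓ` of degree at
most `D`, the formula realized at the coefficients of the `pₛ` holds iff
`dim_R X = d`. -/
theorem realDim_definable (R : Type u) [Field R] [IsRealClosedField R]
    (n ℓ D d : ℕ) :
    ∃ φ : (Language.ring[[(Set.univ : Set R)]]).Formula (Fin ℓ × (Fin n →₀ ℕ)),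
      ∀ p : Fin ℓ → MvPolynomial (Fin n) R,
        (∀ s, (p s).totalDegree ≤ D) →
        vanishIdeal (realZeroSet p) = Ideal.span (Set.range p) →
        (φ.Realize (fun q => MvPolynomial.coeff q.2 (p q.1)) ↔
          realDim (realZeroSet p) = (d : WithBot (WithTop ℕ))) := by
  obtain ⟨φ, hφ⟩ := definable_setOf_ringKrullDim_eq (Set.univ : Set R)
    (Submodule.fg_span (Set.finite_range (generalPoly (σ := Fin n) (ι := Fin ℓ) D))) d
  refine ⟨φ, fun p hp hI ↦ ?_⟩
  have hmem := congr((fun q ↦ (p q.1).coeff q.2) ∈ $hφ)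
  have hmap : MvPolynomial.map (intEvalHom fun q ↦ (p q.1).coeff q.2) ∘ generalPoly D = p :=
    funext fun s ↦ map_generalPoly (hp s)
  rw [Set.mem_ofPred_eq, Set.mem_ofPred_eq, Ideal.submodule_span_eq, Ideal.map_span,
    ← Set.range_comp, hmap] at hmem
  rw [← hmem, realDim, hI]
  rfl
end
end
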